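/- The set of subfields F of the algebraic closure of ℚ such that the subset ℤ of F is definable by a first-order formula in the language of rings with parameters from F is a meager subset of the space 𝓔 of all subfields of the algebraic closure of ℚ. -/

import Mathlib

open FirstOrder Topology

noncomputable section

/-- `Q̄`, the algebraic closure of `ℚ`. -/
abbrev Qbar : Type := AlgebraicClosure ℚ

/-- `Prop` with the discrete two-point topology. -/
def propDiscrete : TopologicalSpace Prop := ⊥

/-- The product topology on the powerset `2^Q̄`, identified with `Set Q̄ = Q̄ → Prop`,
where each factor `Prop` carries the discrete two-point topology. -/
def powersetTopology : TopologicalSpace (Set Qbar) :=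
  @Pi.topologicalSpace Qbar (fun _ => Prop) (fun _ => propDiscrete)

/-- The space `𝓔` of all subfields of `Q̄`, with the subspace topology induced from `2^Q̄`
via the identification of a subfield with its underlying set of elements. -/
instance subfieldTopology : TopologicalSpace (Subfield Qbar) :=
  powersetTopology.induced (fun F => (F : Set Qbar))

/-- A subset `s` of a field `F` is definable (with parameters) if it is the solution set in `F`
of a first-order formula in the language of rings with parameters from `F`. -/
def DefinableIn (F : Type*) [Field F] (s : Set F) : Prop :=
  letI := FirstOrder.Ring.compatibleRingOfRing F
  Set.Definable₁ (Set.univ : Set F) FirstOrder.Language.ring s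

/-- The subset `ℤ` of a field `F`. -/
def intSet (F : Type*) [Field F] : Set F := Set.range (Int.cast : ℤ → F)

/-- The ring of integers `𝒪_F` of `F`: the integral closure of `ℤ` in `F`. -/
def ringOfIntegers (F : Type*) [Field F] : Set F := {x : F | IsIntegral ℤ x}

namespace Hit

open Polynomial

theorem dvd_evalEval_sub {P : ℤ[X][X]} {n t t' y y' : ℤ} (ht : n ∣ t - t') (hy : n ∣ y - y') :
    n ∣ P.evalEval t y - P.evalEval t' y' := by
  have h1 : n ∣ P.evalEval t y - P.evalEval t y' := by
    rw [← map_evalRingHom_eval, ← map_evalRingHom_eval]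
    exact hy.trans (sub_dvd_eval_sub _ _ _)
  have h2 : n ∣ P.evalEval t y' - P.evalEval t' y' := by
    simp only [evalEval]
    exact ht.trans (sub_dvd_eval_sub _ _ _)
  have := dvd_add h1 h2
  simpa using this

theorem exists_hensel_approx (P : ℤ[X][X]) {p η a : ℤ}
    (ha : p ∣ a * (derivative P).evalEval 0 η - 1) (m : ℕ) :
    ∃ Y : ℤ[X], ∀ t y : ℤ, p ∣ t → p ∣ y - η → P.evalEval t y = 0 →
      p ^ (m + 1) ∣ Y.eval t - y := by
  induction m with
  | zero =>
    refine ⟨C η, fun t y _ hy _ ↦ ?_⟩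
    rw [eval_C, zero_add, pow_one, ← dvd_neg]
    simpa using hy
  | succ m ih =>
    obtain ⟨Y, hY⟩ := ih
    refine ⟨Y - C a * P.eval Y, fun t y ht hy h0 ↦ ?_⟩
    have h := hY t y ht hy h0
    obtain ⟨δ, hδ⟩ : ∃ δ, Y.eval t = y + δ := ⟨Y.eval t - y, by ring⟩
    rw [hδ, add_sub_cancel_left] at h
    obtain ⟨c, hc⟩ := (P.map (evalRingHom t)).binomExpansion y δ
    have h1 : (P.eval Y).eval t = (P.map (evalRingHom t)).eval (y + δ) := by
      rw [← hδ, ← coe_evalRingHom, ← eval₂_hom, eval_map]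
    simp only [derivative_map, map_evalRingHom_eval, h0, zero_add] at hc
    have h2 : p ∣ (derivative P).evalEval t y - (derivative P).evalEval 0 η :=
      dvd_evalEval_sub (by simpa using ht) hy
    have h3 : p ∣ 1 - a * (derivative P).evalEval t y := by
      have := dvd_add (h2.mul_left a) ha
      refine (dvd_neg.2 this).trans (dvd_of_eq ?_)
      ring
    have h4 : p ∣ δ := (dvd_pow_self p (by omega)).trans h
    have : (Y - C a * P.eval Y).eval t - y =
        δ * (1 - a * (derivative P).evalEval t y) - (δ * δ) * (a * c) := by
      rw [eval_sub, eval_mul, eval_C, h1, map_evalRingHom_eval, hc, hδ]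
      ring
    rw [this, pow_succ]
    exact dvd_sub (mul_dvd_mul h h3) ((mul_dvd_mul h h4).mul_right _)

theorem exists_small_combination {ι : Type*} [Fintype ι] [Nonempty ι] (w : ι → ℕ) (M q : ℕ)
    (hq : 0 < q) (f : ι → ℤ[X]) (hw : ∑ l ∈ Finset.range M, (M - l) ≤ ∑ i, w i) :
    ∃ c : ι → ℤ, c ≠ 0 ∧ (∀ i, |c i| ≤ (q : ℤ) ^ w i) ∧
      ∀ l < M, (q : ℤ) ^ (M - l) ∣ (∑ i, C (c i) * f i).coeff l := by
  classical
  have hq' (n : ℕ) : NeZero (q ^ n) := ⟨(pow_pos hq n).ne'⟩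
  let g : (∀ i, Fin (q ^ w i + 1)) → ∀ l : Fin M, ZMod (q ^ (M - (l : ℕ))) :=
    fun x l ↦ (((∑ i, C ((x i : ℕ) : ℤ) * f i).coeff l : ℤ) : ZMod _)
  have hlt : ∏ i, q ^ w i < ∏ i, (q ^ w i + 1) :=
    Finset.prod_lt_prod_of_nonempty (fun i _ ↦ pow_pos hq _) (fun i _ ↦ Nat.lt_succ_self _)
      Finset.univ_nonempty
  have hcard : Fintype.card (∀ l : Fin M, ZMod (q ^ (M - (l : ℕ)))) <
      Fintype.card (∀ i, Fin (q ^ w i + 1)) := by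
    simp only [Fintype.card_pi, ZMod.card, Fintype.card_fin]
    refine lt_of_le_of_lt ?_ hlt
    rw [Finset.prod_pow_eq_pow_sum, Finset.prod_pow_eq_pow_sum,
      Fin.sum_univ_eq_sum_range (fun l ↦ M - l) M]
    exact Nat.pow_le_pow_right hq hw
  obtain ⟨x, y, hxy, hg⟩ := Fintype.exists_ne_map_eq_of_card_lt g hcard
  refine ⟨fun i ↦ ((x i : ℕ) : ℤ) - ((y i : ℕ) : ℤ), fun h ↦ hxy ?_, fun i ↦ ?_, fun l hl ↦ ?_⟩
  · funext i
    have := congrFun h i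
    ext
    simp only [Pi.zero_apply] at this
    omega
  · have h1 := (x i).2
    have h2 := (y i).2
    rw [abs_le]
    zify at h1 h2
    constructor <;> linarith [Int.natCast_nonneg (x i : ℕ), Int.natCast_nonneg (y i : ℕ)]
  · have := congrFun hg ⟨l, hl⟩
    simp only [g] at this
    rw [eq_comm, ZMod.intCast_eq_intCast_iff_dvd_sub] at this
    rw [← coeff_sub, ← Finset.sum_sub_distrib] at this
    simp only [← sub_mul, ← C_sub] at this
    exact_mod_cast this

theorem natDegree_det_le {n : ℕ} (A : Matrix (Fin n) (Fin n) ℤ[X]) {B : ℕ}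
    (h : ∀ i j, (A i j).natDegree ≤ B) : A.det.natDegree ≤ n * B := by
  rw [Matrix.det_apply]
  refine natDegree_sum_le_of_forall_le _ _ fun σ _ ↦ ?_
  refine (natDegree_smul_le _ _).trans ((natDegree_prod_le _ _).trans ?_)
  refine (Finset.sum_le_card_nsmul _ _ B fun i _ ↦ h _ _).trans ?_
  simp

theorem natDegree_resultant_le {P Q : ℤ[X][X]} {B : ℕ} (hP : ∀ i, (P.coeff i).natDegree ≤ B)
    (hQ : ∀ i, (Q.coeff i).natDegree ≤ B) (m n : ℕ) :
    (resultant P Q m n).natDegree ≤ (m + n) * B := by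
  refine natDegree_det_le _ fun i j ↦ ?_
  simp only [sylvester, Matrix.of_apply]
  induction j using Fin.addCases with
  | left j => simp only [Fin.addCases_left]; split_ifs <;> simp [hQ]
  | right j => simp only [Fin.addCases_right]; split_ifs <;> simp [hP]

/-- A common-zero bound: a polynomial of small degree in `Y` shares few zeros with an irreducible
monic one. -/
theorem exists_eliminant {P : ℤ[X][X]} (hP : P.Monic) (hirr : Irreducible P) {N : ℕ}
    (hPN : ∀ i, (P.coeff i).natDegree ≤ N) {Q : ℤ[X][X]} (hQN : ∀ i, (Q.coeff i).natDegree ≤ N)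
    (hQ0 : Q ≠ 0) (hQd : Q.natDegree < P.natDegree) :
    ∃ r : ℤ[X], r ≠ 0 ∧ r.natDegree ≤ (P.natDegree + P.natDegree) * N ∧
      ∀ t y : ℤ, P.evalEval t y = 0 → Q.evalEval t y = 0 → r.eval t = 0 := by
  refine ⟨P.resultant Q, ?_, ?_, fun t y h1 h2 ↦ ?_⟩
  · intro h0
    let K := FractionRing ℤ[X]
    have hinj : Function.Injective (algebraMap ℤ[X] K) := IsFractionRing.injective _ _
    have hirr' : Irreducible (P.map (algebraMap ℤ[X] K)) :=
      (hP.irreducible_iff_irreducible_map_fraction_map).1 hirr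
    have h1 : (P.map (algebraMap ℤ[X] K)).resultant (Q.map (algebraMap ℤ[X] K)) = 0 := by
      rw [natDegree_map_eq_of_injective hinj, natDegree_map_eq_of_injective hinj,
        resultant_map_map, h0, map_zero]
    rw [resultant_eq_zero_iff] at h1
    apply h1.2
    rw [hirr'.coprime_iff_not_dvd]
    intro hd
    have := natDegree_le_of_dvd hd (by rwa [Polynomial.map_ne_zero_iff hinj])
    rw [natDegree_map_eq_of_injective hinj, natDegree_map_eq_of_injective hinj] at this
    omega
  · refine (natDegree_resultant_le hPN hQN _ _).trans ?_
    gcongr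
  · obtain ⟨p, q, -, -, h⟩ := exists_mul_add_mul_eq_C_resultant P Q le_rfl le_rfl
      (Or.inl (by omega : P.natDegree ≠ 0))
    have := congrArg (evalEval t y) h
    rw [evalEval_add, evalEval_mul, evalEval_mul, h1, h2] at this
    rw [evalEval_C] at this
    simpa using this.symm

theorem exists_abs_eval_le (f : ℤ[X]) :
    ∃ C : ℕ, ∀ t : ℤ, 1 ≤ t → |f.eval t| ≤ C * t ^ f.natDegree := by
  refine ⟨∑ i ∈ Finset.range (f.natDegree + 1), (f.coeff i).natAbs, fun t ht ↦ ?_⟩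
  rw [eval_eq_sum_range]
  refine (Finset.abs_sum_le_sum_abs _ _).trans ?_
  push_cast
  rw [Finset.sum_mul]
  refine Finset.sum_le_sum fun i hi ↦ ?_
  rw [abs_mul, abs_pow, abs_of_pos (by omega : 0 < t)]
  gcongr
  simpa [Nat.lt_succ_iff] using hi

/-- Growth bound for integral roots of a monic bivariate polynomial. -/
theorem exists_root_bound {P : ℤ[X][X]} (hP : P.Monic) :
    ∃ C D : ℕ, ∀ t y : ℤ, 1 ≤ t → P.evalEval t y = 0 → |y| ≤ C * t ^ D := by
  choose c hc using exists_abs_eval_le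
  set d := P.natDegree with hd
  refine ⟨∑ i ∈ Finset.range d, c (P.coeff i), ∑ i ∈ Finset.range d, (P.coeff i).natDegree,
    fun t y ht h ↦ ?_⟩
  rcases eq_or_ne y 0 with rfl | hy
  · simp only [abs_zero]
    positivity
  have hy1 : 1 ≤ |y| := Int.one_le_abs hy
  have h1 : y ^ d = - ∑ i ∈ Finset.range d, (P.coeff i).eval t * y ^ i := by
    rw [← map_evalRingHom_eval, eval_eq_sum_range' (n := d + 1), Finset.sum_range_succ] at h
    · simp only [coeff_map, coe_evalRingHom] at h
      have hl : P.coeff d = 1 := hP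
      rw [hl] at h
      simp only [eval_one, one_mul] at h
      linarith
    · exact Nat.lt_succ_of_le natDegree_map_le
  rcases Nat.eq_zero_or_pos d with h0 | hpos
  · rw [h0] at h1; simp at h1
  have h2 : |y| * |y| ^ (d - 1) ≤ (∑ i ∈ Finset.range d, |(P.coeff i).eval t|) * |y| ^ (d - 1) := by
    rw [← pow_succ', Nat.sub_add_cancel hpos, ← abs_pow, h1, abs_neg, Finset.sum_mul]
    refine (Finset.abs_sum_le_sum_abs _ _).trans (Finset.sum_le_sum fun i hi ↦ ?_)
    rw [abs_mul, abs_pow]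
    have := Finset.mem_range.1 hi
    gcongr
    omega
  refine (le_of_mul_le_mul_right h2 (by positivity)).trans ?_
  push_cast
  rw [Finset.sum_mul]
  refine Finset.sum_le_sum fun i hi ↦ (hc _ t ht).trans ?_
  gcongr
  exact Finset.single_le_sum (f := fun i ↦ (P.coeff i).natDegree) (fun _ _ ↦ Nat.zero_le _) hi

theorem weight_inequality (D d : ℕ) (hd : 2 ≤ d) :
    let N := D * d + 2
    let E := d * (N + 1)
    ∑ l ∈ Finset.range (E + 1), (E + 1 - l) ≤
      ∑ i : Fin (N + 1) × Fin d, (E - (i.1 : ℕ) - D * (i.2 : ℕ)) := by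
  intro N E
  have hNE : N + D * d ≤ E := by
    simp only [E, N]
    nlinarith [Nat.mul_le_mul_left (D * d) hd]
  have h1 : ∑ i : Fin (N + 1) × Fin d, (((E - (i.1 : ℕ) - D * (i.2 : ℕ) : ℕ)) : ℤ) =
      ∑ i : Fin (N + 1) × Fin d, ((E : ℤ) - (i.1 : ℕ) - D * (i.2 : ℕ)) := by
    refine Finset.sum_congr rfl fun i _ ↦ ?_
    have ha : (i.1 : ℕ) ≤ N := Nat.lt_succ_iff.1 i.1.2
    have hb : D * (i.2 : ℕ) ≤ D * d := Nat.mul_le_mul_left _ i.2.2.le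
    rw [Nat.cast_sub (by omega), Nat.cast_sub (by omega)]
    push_cast
    ring
  have g (n : ℕ) : 2 * ∑ i : Fin n, ((i : ℕ) : ℤ) = n * (n - 1) := by
    induction n with
    | zero => simp
    | succ n ih =>
      rw [Fin.sum_univ_castSucc, mul_add]
      simp only [Fin.val_castSucc]
      rw [ih]
      push_cast [Fin.val_last]
      ring
  have h2 : 2 * ∑ i : Fin (N + 1) × Fin d, ((E : ℤ) - (i.1 : ℕ) - D * (i.2 : ℕ)) =
      2 * (N + 1) * d * E - d * ((N + 1) * N) - D * (N + 1) * (d * (d - 1)) := by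
    rw [Fintype.sum_prod_type]
    simp only [Finset.sum_sub_distrib, ← Finset.mul_sum, Finset.sum_const, Finset.card_univ,
      Fintype.card_fin, nsmul_eq_mul]
    have g1 := g (N + 1)
    have g2 := g d
    push_cast at g1 ⊢
    linear_combination (-(d : ℤ)) * g1 - D * (N + 1) * g2
  have h3 (n : ℕ) : 2 * ∑ l ∈ Finset.range n, (((n - l : ℕ)) : ℤ) = n * (n + 1) := by
    induction n with
    | zero => simp
    | succ n ih =>
      rw [Finset.sum_range_succ', mul_add]
      simp only [Nat.add_sub_add_right, ih]
      push_cast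
      ring
  zify
  rw [h1]
  have h4 := h3 (E + 1)
  have hE : (E : ℤ) = d * (N + 1) := by simp [E]
  have hN : (N : ℤ) = D * d + 2 := by simp [N]
  have hd' : (2 : ℤ) ≤ d := by exact_mod_cast hd
  have hD' : (0 : ℤ) ≤ D := by positivity
  push_cast at h4
  have h5 : 2 * ∑ i : Fin (N + 1) × Fin d, ((E : ℤ) - (i.1 : ℕ) - D * (i.2 : ℕ)) =
      2 * E * E - E * N - D * E * (d - 1) := by
    rw [h2, hE]; ring
  have h6 : ((E : ℤ) + 1) * (E + 1 + 1) ≤ 2 * E * E - E * N - D * E * (d - 1) := by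
    have : (N : ℤ) + D * (d - 1) + 4 ≤ E := by
      rw [hE, hN]; nlinarith
    have hEp : (6 : ℤ) ≤ E := by rw [hE, hN]; nlinarith
    nlinarith
  linarith

theorem exists_uniform_eliminant {P : ℤ[X][X]} (hP : P.Monic) (hirr : Irreducible P)
    (hd : 2 ≤ P.natDegree) {p : ℕ} (hp : 2 ≤ p) {η a : ℤ}
    (ha : (p : ℤ) ∣ a * (derivative P).evalEval 0 η - 1) :
    ∃ B : ℕ, ∀ J : ℕ, ∃ k₀ : ℕ, ∀ k ≥ k₀, ∃ r : ℤ[X], r ≠ 0 ∧ r.natDegree ≤ B ∧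
      ∀ j : ℕ, 1 ≤ j → j ≤ J → ∀ y : ℤ, (p : ℤ) ∣ y - η →
        P.evalEval ((p : ℤ) ^ k * j) y = 0 → r.eval ((p : ℤ) ^ k * j) = 0 := by
  classical
  obtain ⟨C₀, D, hCD⟩ := exists_root_bound hP
  set d := P.natDegree with hd_def
  set N := D * d + 2 with hN
  set E := d * (N + 1) with hE
  have hNE : N + D * d ≤ E := by
    simp only [hE, hN]
    nlinarith [Nat.mul_le_mul_left (D * d) hd]
  set N' := N + ∑ i ∈ Finset.range (d + 1), (P.coeff i).natDegree with hN'
  have hPN (i : ℕ) : (P.coeff i).natDegree ≤ N' := by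
    by_cases hi : i ∈ Finset.range (d + 1)
    · exact (Finset.single_le_sum (f := fun i ↦ (P.coeff i).natDegree)
        (fun _ _ ↦ Nat.zero_le _) hi).trans (Nat.le_add_left _ _)
    · rw [coeff_eq_zero_of_natDegree_lt (by simpa using hi)]
      simp
  refine ⟨(d + d) * N', fun J ↦ ?_⟩
  set K : ℕ := ((N + 1) * d) * ((C₀ + 1) ^ d * (J + 1) ^ (N + D * d)) with hK
  refine ⟨K + 1, fun k hk ↦ ?_⟩
  set q := p ^ k with hq
  have hKq : K < q := lt_of_lt_of_le (by omega : K < k) (Nat.lt_pow_self hp).le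
  have hq0 : 0 < q := by omega
  obtain ⟨Y, hY⟩ := exists_hensel_approx P ha (k * (E + 1))
  have : Nonempty (Fin d) := ⟨⟨0, by omega⟩⟩
  obtain ⟨c, hc0, hc, hcM⟩ := exists_small_combination
    (fun i : Fin (N + 1) × Fin d ↦ E - (i.1 : ℕ) - D * (i.2 : ℕ)) (E + 1) q hq0
    (fun i ↦ X ^ (i.1 : ℕ) * Y ^ (i.2 : ℕ)) (weight_inequality D d hd)
  let Q : ℤ[X][X] := ∑ i : Fin (N + 1) × Fin d, C (C (c i) * X ^ (i.1 : ℕ)) * X ^ (i.2 : ℕ)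
  have hQcoeff (b : Fin d) : Q.coeff b = ∑ a : Fin (N + 1), C (c (a, b)) * X ^ (a : ℕ) := by
    simp only [Q, finsetSum_coeff, coeff_C_mul, coeff_X_pow, Fintype.sum_prod_type]
    refine Finset.sum_congr rfl fun a _ ↦ ?_
    rw [Finset.sum_eq_single b]
    · simp
    · intro b' _ hb
      rw [if_neg (fun h ↦ hb (Fin.ext h.symm)), mul_zero]
    · simp
  have hQdeg : Q.natDegree < d := by
    refine lt_of_le_of_lt (natDegree_sum_le_of_forall_le (n := d - 1) _ _ fun i _ ↦ ?_) (by omega)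
    exact (natDegree_C_mul_X_pow_le _ _).trans (by have := i.2.2; omega)
  have hQ0 : Q ≠ 0 := by
    intro h
    apply hc0
    funext ⟨a, b⟩
    have h1 := hQcoeff b
    rw [h, coeff_zero] at h1
    have h2 := congrArg (fun f ↦ f.coeff (a : ℕ)) h1
    simp only [coeff_zero, finsetSum_coeff, coeff_C_mul, coeff_X_pow] at h2
    rw [Finset.sum_eq_single a] at h2
    · simpa using h2.symm
    · intro a' _ ha
      rw [if_neg (fun h ↦ ha (Fin.ext h.symm)), mul_zero]
    · simp
  have hQN (i : ℕ) : (Q.coeff i).natDegree ≤ N' := by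
    by_cases hi : i < d
    · rw [show i = ((⟨i, hi⟩ : Fin d) : ℕ) from rfl, hQcoeff]
      refine (natDegree_sum_le_of_forall_le (n := N) _ _ fun a _ ↦ ?_).trans (Nat.le_add_right _ _)
      exact (natDegree_C_mul_X_pow_le _ _).trans (by have := a.2; omega)
    · rw [coeff_eq_zero_of_natDegree_lt (by omega)]
      simp
  have hQeval (t y : ℤ) : Q.evalEval t y =
      ∑ i : Fin (N + 1) × Fin d, c i * t ^ (i.1 : ℕ) * y ^ (i.2 : ℕ) := by
    simp only [Q, evalEval_finsetSum, evalEval_mul, evalEval_pow, evalEval_C, evalEval_X, eval_mul,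
      eval_C, eval_pow, eval_X]
  obtain ⟨r, hr0, hrd, hr⟩ := exists_eliminant hP hirr hPN hQN hQ0 hQdeg
  refine ⟨r, hr0, hrd, fun j hj1 hjJ y hy h0 ↦ hr _ y h0 ?_⟩
  set t : ℤ := (p : ℤ) ^ k * j with ht
  have htq : t = (q : ℤ) * j := by simp [ht, hq]
  have hq1 : (1 : ℤ) ≤ q := by exact_mod_cast hq0
  have hj1' : (1 : ℤ) ≤ j := by exact_mod_cast hj1
  have ht1 : 1 ≤ t := by rw [htq]; nlinarith
  have hdvd : (q : ℤ) ^ (E + 1) ∣ Q.evalEval t y := by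
    have h1 : (q : ℤ) ^ (E + 1) ∣ Q.evalEval t y - Q.evalEval t (Y.eval t) := by
      apply dvd_evalEval_sub (by simp)
      have := hY t y ((dvd_pow_self _ (by omega)).mul_right _) hy h0
      rw [← dvd_neg, neg_sub]
      refine Dvd.dvd.trans ?_ this
      rw [hq]
      push_cast
      rw [← pow_mul]
      exact pow_dvd_pow _ (Nat.le_succ _)
    have h2 : (q : ℤ) ^ (E + 1) ∣ Q.evalEval t (Y.eval t) := by
      have h3 : Q.evalEval t (Y.eval t) =
          (∑ i : Fin (N + 1) × Fin d, C (c i) * (X ^ (i.1 : ℕ) * Y ^ (i.2 : ℕ))).eval t := by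
        rw [hQeval, eval_finsetSum]
        simp [mul_assoc]
      rw [h3, eval_eq_sum_range]
      refine Finset.dvd_sum fun l _ ↦ ?_
      rw [htq, mul_pow, ← mul_assoc]
      refine Dvd.dvd.mul_right ?_ _
      by_cases hl : l < E + 1
      · rw [← Nat.sub_add_cancel hl.le, pow_add]
        exact mul_dvd_mul (hcM l hl) dvd_rfl
      · exact (pow_dvd_pow _ (by omega)).mul_left _
    have := dvd_add h1 h2
    simpa using this
  refine Int.eq_zero_of_abs_lt_dvd hdvd ?_
  have hb : |Q.evalEval t y| ≤ (q : ℤ) ^ E * K := by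
    rw [hQeval]
    refine (Finset.abs_sum_le_sum_abs _ _).trans ?_
    refine (Finset.sum_le_card_nsmul _ _
      ((q : ℤ) ^ E * ((C₀ + 1) ^ d * (J + 1) ^ (N + D * d))) fun i _ ↦ ?_).trans ?_
    · have hi1 : (i.1 : ℕ) ≤ N := Nat.lt_succ_iff.1 i.1.2
      have hi2 : (i.2 : ℕ) ≤ d := i.2.2.le
      have hDi : D * (i.2 : ℕ) ≤ D * d := Nat.mul_le_mul_left _ hi2
      rw [abs_mul, abs_mul, abs_pow, abs_pow, abs_of_pos (by omega : 0 < t)]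
      calc |c i| * t ^ (i.1 : ℕ) * |y| ^ (i.2 : ℕ)
          ≤ (q : ℤ) ^ (E - (i.1 : ℕ) - D * (i.2 : ℕ)) * t ^ (i.1 : ℕ) *
              (C₀ * t ^ D) ^ (i.2 : ℕ) := by
            gcongr
            · exact hc i
            · exact hCD t y ht1 h0
        _ = (q : ℤ) ^ E * ((C₀ : ℤ) ^ (i.2 : ℕ) * (j : ℤ) ^ ((i.1 : ℕ) + D * (i.2 : ℕ))) := by
            rw [htq, mul_pow, mul_pow, mul_pow, mul_pow, ← pow_mul, ← pow_mul]
            have : E = (E - (i.1 : ℕ) - D * (i.2 : ℕ)) + (i.1 : ℕ) + D * (i.2 : ℕ) := by omega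
            conv_rhs => rw [this]
            simp only [pow_add]
            ring
        _ ≤ _ := by
            gcongr
            · calc (C₀ : ℤ) ^ (i.2 : ℕ) ≤ (C₀ + 1) ^ (i.2 : ℕ) := by gcongr; omega
                _ ≤ _ := by gcongr; omega
            · calc (j : ℤ) ^ ((i.1 : ℕ) + D * (i.2 : ℕ))
                    ≤ (J + 1) ^ ((i.1 : ℕ) + D * (i.2 : ℕ)) := by gcongr; omega
                _ ≤ _ := by gcongr; omega
    · simp only [Finset.card_univ, Fintype.card_prod, Fintype.card_fin, nsmul_eq_mul, hK]
      push_cast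
      apply le_of_eq
      ring
  refine hb.trans_lt ?_
  rw [pow_succ]
  gcongr

/-- `P(p ^ k * j, Y)` has an integral root for few `j`, for all large `k`. -/
theorem exists_card_root_le {P : ℤ[X][X]} (hP : P.Monic) (hirr : Irreducible P)
    (hd : 2 ≤ P.natDegree) {p : ℕ} (hp : p.Prime)
    (hpP : ∀ y : ℤ, (p : ℤ) ∣ P.evalEval 0 y → ¬ (p : ℤ) ∣ (derivative P).evalEval 0 y) :
    ∃ B : ℕ, ∀ J : ℕ, ∃ k₀ : ℕ, ∀ k ≥ k₀,
      {j : ℕ | 1 ≤ j ∧ j ≤ J ∧ ∃ y, P.evalEval ((p : ℤ) ^ k * j) y = 0}.ncard ≤ B := by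
  classical
  have key (η : ℕ) : ∃ B : ℕ, ∀ J : ℕ, ∃ k₀ : ℕ, ∀ k ≥ k₀,
      {j : ℕ | 1 ≤ j ∧ j ≤ J ∧ ∃ y, (p : ℤ) ∣ y - η ∧
        P.evalEval ((p : ℤ) ^ k * j) y = 0}.ncard ≤ B := by
    by_cases hη : (p : ℤ) ∣ P.evalEval 0 η
    · have hco : IsCoprime ((derivative P).evalEval 0 (η : ℤ)) (p : ℤ) :=
        ((Nat.prime_iff_prime_int.1 hp).irreducible.coprime_iff_not_dvd.2 (hpP _ hη)).symm
      obtain ⟨a, b, hab⟩ := hco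
      obtain ⟨B, hB⟩ := exists_uniform_eliminant hP hirr hd hp.two_le (η := η) (a := a)
        ⟨-b, by linear_combination hab⟩
      refine ⟨B, fun J ↦ ?_⟩
      obtain ⟨k₀, hk₀⟩ := hB J
      refine ⟨k₀, fun k hk ↦ ?_⟩
      obtain ⟨r, hr0, hrB, hr⟩ := hk₀ k hk
      refine le_trans ?_ ((card_roots' r).trans hrB)
      refine le_trans ?_ (Multiset.toFinset_card_le _)
      rw [← Set.ncard_coe_finset]
      refine Set.ncard_le_ncard_of_injOn (fun j : ℕ ↦ (p : ℤ) ^ k * j) ?_ ?_ (Finset.finite_toSet _)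
      · rintro j ⟨h1, h2, y, hy, h0⟩
        simp only [Finset.mem_coe, Multiset.mem_toFinset, mem_roots hr0, IsRoot]
        exact hr j h1 h2 y hy h0
      · intro j _ j' _ h
        have hpk : (p : ℤ) ^ k ≠ 0 := pow_ne_zero _ (by exact_mod_cast hp.ne_zero)
        exact_mod_cast mul_left_cancel₀ hpk h
    · refine ⟨0, fun J ↦ ⟨1, fun k hk ↦ ?_⟩⟩
      rw [Nat.le_zero]
      convert Set.ncard_empty ℕ
      rw [Set.eq_empty_iff_forall_notMem]
      rintro j ⟨-, -, y, hy, h0⟩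
      apply hη
      have h1 : (p : ℤ) ∣ P.evalEval ((p : ℤ) ^ k * j) y - P.evalEval 0 (η : ℤ) :=
        dvd_evalEval_sub (by
          rw [sub_zero]; exact (dvd_pow_self _ (by omega : k ≠ 0)).mul_right _) hy
      rw [h0, zero_sub, dvd_neg] at h1
      exact h1
  choose B hB using key
  refine ⟨∑ η ∈ Finset.range p, B η, fun J ↦ ?_⟩
  choose k₀ hk₀ using fun η ↦ hB η J
  refine ⟨∑ η ∈ Finset.range p, k₀ η, fun k hk ↦ ?_⟩
  refine le_trans (Set.ncard_le_ncard (t := ⋃ η ∈ Finset.range p, {j : ℕ | 1 ≤ j ∧ j ≤ J ∧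
    ∃ y, (p : ℤ) ∣ y - η ∧ P.evalEval ((p : ℤ) ^ k * j) y = 0}) ?_ ?_) ?_
  · rintro j ⟨h1, h2, y, h0⟩
    have hp0 : (0 : ℤ) < p := by exact_mod_cast hp.pos
    simp only [Set.mem_iUnion, Finset.mem_range]
    have h3 := Int.emod_nonneg y hp0.ne'
    have h4 := Int.emod_lt_of_pos y hp0
    refine ⟨(y % p).toNat, by omega, h1, h2, y, ?_, h0⟩
    rw [Int.toNat_of_nonneg h3]
    exact Int.dvd_self_sub_emod
  · exact (Set.finite_Icc 1 J).subset fun j ↦ by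
      simp only [Set.mem_iUnion]
      rintro ⟨η, -, h1, h2, -⟩
      exact ⟨h1, h2⟩
  · refine (Finset.set_ncard_biUnion_le _ _).trans (Finset.sum_le_sum fun η hη ↦ hk₀ η k ?_)
    exact (Finset.single_le_sum (f := k₀) (fun _ _ ↦ Nat.zero_le _) hη).trans hk

/-- Irreducible monic bivariate polynomials have nonzero discriminant. -/
theorem exists_separating {P : ℤ[X][X]} (hP : P.Monic) (hirr : Irreducible P)
    (hd : 0 < P.natDegree) : ∃ r : ℤ[X], r ≠ 0 ∧ ∀ s y n : ℤ,
      n ∣ P.evalEval s y → n ∣ (derivative P).evalEval s y → n ∣ r.eval s := by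
  refine ⟨P.resultant (derivative P), ?_, fun s y n h1 h2 ↦ ?_⟩
  · intro h0
    let K := FractionRing ℤ[X]
    have hinj : Function.Injective (algebraMap ℤ[X] K) := IsFractionRing.injective _ _
    have hirr' : Irreducible (P.map (algebraMap ℤ[X] K)) :=
      (hP.irreducible_iff_irreducible_map_fraction_map).1 hirr
    have h1 : (P.map (algebraMap ℤ[X] K)).resultant
        ((derivative P).map (algebraMap ℤ[X] K)) = 0 := by
      rw [natDegree_map_eq_of_injective hinj, natDegree_map_eq_of_injective hinj,
        resultant_map_map, h0, map_zero]
    rw [resultant_eq_zero_iff] at h1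
    apply h1.2
    rw [← derivative_map]
    exact hirr'.separable
  · obtain ⟨u, v, -, -, h⟩ := exists_mul_add_mul_eq_C_resultant P (derivative P) le_rfl le_rfl
      (Or.inl hd.ne')
    have := congrArg (evalEval s y) h
    rw [evalEval_add, evalEval_mul, evalEval_mul, evalEval_C] at this
    rw [← this]
    exact dvd_add (h1.mul_right _) (h2.mul_right _)

theorem exists_monic_factorization {P : ℤ[X][X]} (hP : P.Monic) :
    ∃ s : Multiset ℤ[X][X], (∀ f ∈ s, f.Monic ∧ Irreducible f) ∧ s.prod = P := by
  induction h : P.natDegree using Nat.strong_induction_on generalizing P with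
  | _ n ih =>
    by_cases h1 : P = 1
    · exact ⟨0, by simp, by simp [h1]⟩
    by_cases hirr : Irreducible P
    · exact ⟨{P}, by simp [hP, hirr], by simp⟩
    rw [hP.irreducible_iff_natDegree] at hirr
    push Not at hirr
    obtain ⟨f, g, hf, hg, hfg, hf0, hg0⟩ := hirr h1
    have hdeg := hf.natDegree_mul hg
    rw [hfg] at hdeg
    obtain ⟨s, hs, rfl⟩ := ih f.natDegree (by omega) hf rfl
    obtain ⟨s', hs', rfl⟩ := ih g.natDegree (by omega) hg rfl
    refine ⟨s + s', fun x hx ↦ ?_, by rw [Multiset.prod_add, hfg]⟩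
    rcases Multiset.mem_add.1 hx with hx | hx
    exacts [hs x hx, hs' x hx]

/-- Few members of the progressions `s + p ^ k * j` admit an integral root of `P`. -/
def FewRoots (s : ℤ) (p : ℕ) (P : ℤ[X][X]) : Prop :=
  ∃ B : ℕ, ∀ J : ℕ, ∃ k₀ : ℕ, ∀ k ≥ k₀,
    {j : ℕ | 1 ≤ j ∧ j ≤ J ∧ ∃ y, P.evalEval (s + (p : ℤ) ^ k * j) y = 0}.ncard ≤ B

theorem FewRoots.mul {s : ℤ} {p : ℕ} {P Q : ℤ[X][X]} (hP : FewRoots s p P) (hQ : FewRoots s p Q) :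
    FewRoots s p (P * Q) := by
  obtain ⟨B, hB⟩ := hP
  obtain ⟨B', hB'⟩ := hQ
  refine ⟨B + B', fun J ↦ ?_⟩
  obtain ⟨k, hk⟩ := hB J
  obtain ⟨k', hk'⟩ := hB' J
  refine ⟨k + k', fun m hm ↦ ?_⟩
  refine le_trans ?_ (add_le_add (hk m (by omega)) (hk' m (by omega)))
  refine le_trans (Set.ncard_le_ncard ?_ ?_) (Set.ncard_union_le _ _)
  · rintro j ⟨h1, h2, y, h0⟩
    rw [evalEval_mul, mul_eq_zero] at h0
    rcases h0 with h0 | h0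
    exacts [Or.inl ⟨h1, h2, y, h0⟩, Or.inr ⟨h1, h2, y, h0⟩]
  · refine (Set.finite_Icc 1 J).subset ?_
    rintro j (⟨h1, h2, -⟩ | ⟨h1, h2, -⟩)
    exacts [⟨h1, h2⟩, ⟨h1, h2⟩]

theorem FewRoots.multiset_prod {s : ℤ} {p : ℕ} {S : Multiset ℤ[X][X]}
    (h : ∀ f ∈ S, FewRoots s p f) : FewRoots s p S.prod := by
  induction S using Multiset.induction_on with
  | empty =>
    refine ⟨0, fun J ↦ ⟨0, fun k _ ↦ ?_⟩⟩
    simp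
  | cons f S ih =>
    rw [Multiset.prod_cons]
    exact (h f (Multiset.mem_cons_self _ _)).mul
      (ih fun g hg ↦ h g (Multiset.mem_cons_of_mem hg))

theorem fewRoots_of_irreducible {P : ℤ[X][X]} (hP : P.Monic) (hirr : Irreducible P)
    (hd : 2 ≤ P.natDegree) {s : ℤ} {p : ℕ} (hp : p.Prime)
    (hpP : ∀ y : ℤ, (p : ℤ) ∣ P.evalEval s y → ¬ (p : ℤ) ∣ (derivative P).evalEval s y) :
    FewRoots s p P := by
  let e : ℤ[X] ≃+* ℤ[X] := (algEquivAevalXAddC s).toRingEquiv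
  have he (f : ℤ[X]) (t : ℤ) : (e f).eval t = f.eval (s + t) := by
    change (aeval (X + C s) f).eval t = _
    rw [← comp_eq_aeval, eval_comp]
    simp [add_comm]
  have hE (Q : ℤ[X][X]) (t y : ℤ) : (Q.map (e : ℤ[X] →+* ℤ[X])).evalEval t y =
      Q.evalEval (s + t) y := by
    rw [← map_evalRingHom_eval, ← map_evalRingHom_eval, map_map]
    congr 2
    ext
    · simp
    · simp [he]
  obtain ⟨B, hB⟩ := exists_card_root_le (P := P.map (e : ℤ[X] →+* ℤ[X])) (hP.map _)
    ((MulEquiv.irreducible_iff (mapEquiv e)).2 hirr)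
    (by rwa [natDegree_map_eq_of_injective (f := (e : ℤ[X] →+* ℤ[X])) e.injective]) hp
    (fun y h1 h2 ↦ hpP y (by simpa [hE] using h1)
      (by rw [derivative_map] at h2; simpa [hE] using h2))
  exact ⟨B, fun J ↦ (hB J).imp fun k hk m hm ↦ by simpa only [hE] using hk m hm⟩

/-- A rootless form of Hilbert's irreducibility theorem. -/
theorem exists_specialization_no_root {P : ℤ[X][X]} (hP : P.Monic) (hroot : ∀ y, P.eval y ≠ 0)
    (N : ℤ) : ∃ t ≥ N, ∀ y : ℤ, P.evalEval t y ≠ 0 := by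
  classical
  obtain ⟨S, hS, hSP⟩ := exists_monic_factorization hP
  have hdeg (f) (hf : f ∈ S) : 2 ≤ f.natDegree := by
    by_contra! hlt
    have hfm := (hS f hf).1
    have h1 : f.natDegree = 1 := by
      have : f.natDegree ≠ 0 := fun h ↦ (hS f hf).2.1 (by
        rw [hfm.natDegree_eq_zero.1 h]; exact isUnit_one)
      omega
    have h2 := hfm.eq_X_add_C h1
    apply hroot (- f.coeff 0)
    obtain ⟨Q, hQ⟩ := Multiset.dvd_prod hf
    rw [← hSP, hQ, eval_mul, h2]
    simp
  have hsep (f : ℤ[X][X]) (hf : f ∈ S) : ∃ r : ℤ[X], r ≠ 0 ∧ ∀ s y n : ℤ,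
      n ∣ f.evalEval s y → n ∣ (derivative f).evalEval s y → n ∣ r.eval s :=
    exists_separating (hS f hf).1 (hS f hf).2 (by have := hdeg f hf; omega)
  have hR : ∃ r : ℤ[X], r ≠ 0 ∧ ∀ f ∈ S, ∀ s y n : ℤ,
      n ∣ f.evalEval s y → n ∣ (derivative f).evalEval s y → n ∣ r.eval s := by
    clear hSP hS hdeg
    induction S using Multiset.induction_on with
    | empty => exact ⟨1, one_ne_zero, by simp⟩
    | cons f S ih =>
      obtain ⟨r, hr0, hr⟩ := ih fun g hg ↦ hsep g (Multiset.mem_cons_of_mem hg)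
      obtain ⟨r', hr'0, hr'⟩ := hsep f (Multiset.mem_cons_self _ _)
      refine ⟨r' * r, mul_ne_zero hr'0 hr0, fun g hg s y n h1 h2 ↦ ?_⟩
      rw [eval_mul]
      rcases Multiset.mem_cons.1 hg with rfl | hg
      · exact (hr' s y n h1 h2).mul_right _
      · exact (hr g hg s y n h1 h2).mul_left _
  obtain ⟨r, hr0, hr⟩ := hR
  obtain ⟨s, hs⟩ : ∃ s, r.eval s ≠ 0 := by
    by_contra! h
    exact hr0 (funext fun s ↦ by simpa using h s)
  obtain ⟨p, hpge, hp⟩ := Nat.exists_infinite_primes ((r.eval s).natAbs + 1)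
  have hpr : ¬ (p : ℤ) ∣ r.eval s := fun h ↦ by
    have := Nat.le_of_dvd (Int.natAbs_pos.2 hs) (Int.natCast_dvd.1 h)
    omega
  have hfew : FewRoots s p P := by
    rw [← hSP]
    exact FewRoots.multiset_prod fun f hf ↦ fewRoots_of_irreducible (hS f hf).1 (hS f hf).2
      (hdeg f hf) hp fun y h1 h2 ↦ hpr (hr f hf s y p h1 h2)
  obtain ⟨B, hB⟩ := hfew
  obtain ⟨k₀, hk₀⟩ := hB (B + 1)
  set k := k₀ + (N - s).toNat with hk
  have h := hk₀ k (by omega)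
  obtain ⟨j, hj, hj'⟩ : ∃ j ∈ Set.Icc 1 (B + 1),
      j ∉ {j : ℕ | 1 ≤ j ∧ j ≤ B + 1 ∧ ∃ y, P.evalEval (s + (p : ℤ) ^ k * j) y = 0} := by
    by_contra! hcon
    have h1 := Set.ncard_le_ncard hcon ((Set.finite_Icc 1 (B + 1)).subset
      fun j hj ↦ ⟨hj.1, hj.2.1⟩)
    rw [Set.ncard_eq_toFinset_card' (Set.Icc 1 (B + 1)), Set.toFinset_Icc, Nat.card_Icc] at h1
    exact absurd (h1.trans h) (by omega)
  refine ⟨s + (p : ℤ) ^ k * j, ?_, fun y hy ↦ hj' ⟨hj.1, hj.2, y, hy⟩⟩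
  have h1 : (k : ℤ) < (p : ℤ) ^ k := by exact_mod_cast Nat.lt_pow_self hp.one_lt
  have h2 : (1 : ℤ) ≤ j := by exact_mod_cast hj.1
  have h3 : N - s ≤ k := by omega
  nlinarith

end Hit

namespace RelAlg

open Polynomial IntermediateField

variable {Ω : Type*} [Field Ω]

/-- `k` is relatively algebraically closed in `K`. -/
def RelClosed (k K : Subfield Ω) : Prop := ∀ x ∈ K, IsAlgebraic k x → x ∈ k

theorem isAlgebraic_iff_subfield {k : Subfield Ω} {x : Ω} :
    IsAlgebraic k x ↔ ∃ p : Polynomial Ω, p ≠ 0 ∧ (∀ n, p.coeff n ∈ k) ∧ p.eval x = 0 := by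
  constructor
  · rintro ⟨p, hp, hx⟩
    refine ⟨p.map k.subtype, ?_, fun n ↦ by simp, ?_⟩
    · rwa [Polynomial.map_ne_zero_iff k.subtype.injective]
    · rw [eval_map]
      exact hx
  · rintro ⟨p, hp, hk, hx⟩
    obtain ⟨q, rfl⟩ : ∃ q : k[X], q.map k.subtype = p := by
      have : p ∈ lifts k.subtype := by
        rw [lifts_iff_coeff_lifts]
        intro n
        exact ⟨⟨_, hk n⟩, rfl⟩
      exact this
    refine ⟨q, fun h ↦ hp (by rw [h, Polynomial.map_zero]), ?_⟩
    rw [eval_map] at hx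
    exact hx

theorem isAlgebraic_mono {k K : Subfield Ω} (h : k ≤ K) {x : Ω} (hx : IsAlgebraic k x) :
    IsAlgebraic K x := by
  rw [isAlgebraic_iff_subfield] at hx ⊢
  obtain ⟨p, hp, hk, h0⟩ := hx
  exact ⟨p, hp, fun n ↦ h (hk n), h0⟩

theorem adjoin_le_adjoin {k K : Subfield Ω} (h : k ≤ K) {S T : Set Ω}
    (hS : S ⊆ (adjoin K T : Set Ω)) {x : Ω} (hx : x ∈ adjoin k S) : x ∈ adjoin K T := by
  have : (adjoin k S).toSubfield ≤ (adjoin K T).toSubfield := by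
    change Subfield.closure _ ≤ _
    rw [Subfield.closure_le]
    rintro y (⟨a, rfl⟩ | hy)
    · exact (adjoin K T).algebraMap_mem ⟨a, h a.2⟩
    · exact hS hy
  exact this hx

theorem adjoin_mono' {k K : Subfield Ω} (h : k ≤ K) {S : Set Ω} {x : Ω} (hx : x ∈ adjoin k S) :
    x ∈ adjoin K S :=
  adjoin_le_adjoin h (subset_adjoin _ _) hx

theorem RelClosed.minpoly_map {k K : Subfield Ω} (hr : RelClosed k K) (h : k ≤ K) {θ : Ω}
    (hθ : IsAlgebraic k θ) : (minpoly k θ).map (Subfield.inclusion h) = minpoly K θ := by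
  let _ : Algebra k K := (Subfield.inclusion h).toAlgebra
  have : IsScalarTower k K Ω := IsScalarTower.of_algebraMap_eq fun _ ↦ rfl
  have hi : IsIntegral k θ := hθ.isIntegral
  have hiK : IsIntegral K θ := hi.tower_top
  have hdvd : minpoly K θ ∣ (minpoly k θ).map (algebraMap k K) :=
    minpoly.dvd_map_of_isScalarTower k K θ
  have hl := integralClosure.mem_lifts_of_monic_of_dvd_map K (minpoly.monic hi)
    (minpoly.monic hiK) hdvd
  have hl' : minpoly K θ ∈ lifts (algebraMap k K) := by
    rw [lifts_iff_coeff_lifts] at hl ⊢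
    intro n
    obtain ⟨⟨c, hc⟩, hcn⟩ := hl n
    have h1 : IsAlgebraic k (c : Ω) :=
      (IsIntegral.map (IsScalarTower.toAlgHom k K Ω) hc).isAlgebraic
    refine ⟨⟨c, hr _ c.2 h1⟩, ?_⟩
    rw [← hcn]
    rfl
  obtain ⟨q, hq, hqd, hqm⟩ := lifts_and_natDegree_eq_and_monic hl' (minpoly.monic hiK)
  have h0 : aeval θ q = 0 := by
    rw [← aeval_map_algebraMap K, hq, minpoly.aeval]
  refine (eq_of_monic_of_dvd_of_natDegree_le (minpoly.monic hiK) ((minpoly.monic hi).map _)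
    hdvd ?_).trans rfl
  rw [← hqd, (minpoly.monic hi).natDegree_map]
  exact natDegree_le_of_dvd (minpoly.dvd k θ h0) hqm.ne_zero

theorem exists_poly_of_mem_adjoin {K : Subfield Ω} {θ : Ω} (hθ : IsAlgebraic K θ) {α : Ω}
    (hα : α ∈ K⟮θ⟯) : ∃ p : K[X], p.natDegree < (minpoly K θ).natDegree ∧ aeval θ p = α := by
  have hi := hθ.isIntegral
  rw [← mem_toSubalgebra, adjoin_simple_toSubalgebra_of_isAlgebraic hθ,
    Algebra.adjoin_singleton_eq_range_aeval] at hα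
  obtain ⟨p, rfl⟩ := hα
  refine ⟨p %ₘ minpoly K θ, ?_, ?_⟩
  · exact natDegree_modByMonic_lt _ (minpoly.monic hi) (minpoly.ne_one K θ)
  · exact minpoly.aeval_modByMonic_minpoly p θ

theorem exists_primitive [CharZero Ω] {k : Subfield Ω} {S : Set Ω} (hS : S.Finite)
    (h : ∀ x ∈ S, IsAlgebraic k x) : ∃ γ, IsAlgebraic k γ ∧ adjoin k S = k⟮γ⟯ := by
  have hfin : FiniteDimensional k (adjoin k S) := by
    have := hS.to_subtype
    exact finiteDimensional_adjoin fun x hx ↦ (h x hx).isIntegral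
  obtain ⟨γ, hγ⟩ := Field.exists_primitive_element k (adjoin k S)
  refine ⟨γ, ?_, ?_⟩
  · exact (Algebra.IsAlgebraic.isAlgebraic (R := k) γ).algebraMap
  · rw [← lift_adjoin_simple, hγ, lift_top]

theorem RelClosed.mem_adjoin [CharZero Ω] {k K : Subfield Ω} (hr : RelClosed k K) (h : k ≤ K)
    {θ α : Ω} (hθ : IsAlgebraic k θ) (hα : IsAlgebraic k α) (hmem : α ∈ K⟮θ⟯) : α ∈ k⟮θ⟯ := by
  obtain ⟨γ, hγ, hγe⟩ := exists_primitive (k := k) (S := {θ, α}) (by simp)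
    (by rintro x (rfl | rfl) <;> assumption)
  have hγK : γ ∈ K⟮θ⟯ := by
    refine adjoin_le_adjoin h (S := {θ, α}) ?_ (hγe ▸ mem_adjoin_simple_self k γ)
    rintro x (rfl | rfl)
    exacts [mem_adjoin_simple_self K x, hmem]
  have hθK := isAlgebraic_mono h hθ
  have hfK : FiniteDimensional K K⟮θ⟯ := adjoin.finiteDimensional hθK.isIntegral
  have hfγ : FiniteDimensional k k⟮γ⟯ := adjoin.finiteDimensional hγ.isIntegral
  have h1 : (minpoly K γ).natDegree ≤ (minpoly K θ).natDegree := by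
    rw [← adjoin.finrank hθK.isIntegral]
    have := minpoly.natDegree_le (A := K) (⟨γ, hγK⟩ : K⟮θ⟯)
    rwa [minpoly_eq] at this
  have hle : k⟮θ⟯ ≤ k⟮γ⟯ := by
    rw [← hγe]
    exact adjoin.mono _ _ _ (by simp)
  have heq : k⟮θ⟯ = k⟮γ⟯ := by
    refine eq_of_le_of_finrank_le hle ?_
    rw [adjoin.finrank hθ.isIntegral, adjoin.finrank hγ.isIntegral]
    rwa [← hr.minpoly_map h hγ, ← hr.minpoly_map h hθ, natDegree_map, natDegree_map] at h1
  rw [heq, ← hγe]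
  exact subset_adjoin _ _ (by simp)

theorem RelClosed.trans {k K L : Subfield Ω} (h₁ : RelClosed k K) (hkK : k ≤ K)
    (h₂ : RelClosed K L) : RelClosed k L :=
  fun x hx ha ↦ h₁ x (h₂ x hx (isAlgebraic_mono hkK ha)) ha

section Ultrapower

variable {I : Type*} (U : Ultrafilter I)

/-- The ultrapower of `M` along `U`. -/
abbrev Ultrapower (M : Type*) : Type _ := (U : Filter I).Germ M

variable {M : Type*} [Field M]

/-- The class of a sequence in the ultrapower. -/
def mk : (I → M) →+* Ultrapower U M := Filter.Germ.coeRingHom _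

variable {U}

theorem mk_surjective : Function.Surjective (mk U (M := M)) := fun x ↦
  Filter.Germ.inductionOn x fun f ↦ ⟨f, rfl⟩

theorem mk_eq_mk {f g : I → M} : mk U f = mk U g ↔ ∀ᶠ i in (U : Filter I), f i = g i :=
  Filter.Germ.coe_eq

theorem mk_eq_zero {f : I → M} : mk U f = 0 ↔ ∀ᶠ i in (U : Filter I), f i = 0 := by
  rw [← map_zero (mk U), mk_eq_mk]
  rfl

variable (U)

/-- The diagonal embedding. -/
def diag : M →+* Ultrapower U M := (mk U).comp (Pi.constRingHom I M)

theorem diag_apply (a : M) : diag U a = mk U fun _ ↦ a := rfl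

/-- The map of ultrapowers induced by a homomorphism of fields. -/
def ultraMap {M' : Type*} [Field M'] (j : M →+* M') : Ultrapower U M →+* Ultrapower U M' where
  toFun := Filter.Germ.map j
  map_one' := by
    change Filter.Germ.map j ((fun _ ↦ 1 : I → M) : Ultrapower U M) = _
    rw [Filter.Germ.map_coe]
    exact mk_eq_mk.2 (Filter.Eventually.of_forall fun i ↦ by simp)
  map_zero' := by
    change Filter.Germ.map j ((fun _ ↦ 0 : I → M) : Ultrapower U M) = _
    rw [Filter.Germ.map_coe]
    exact mk_eq_mk.2 (Filter.Eventually.of_forall fun i ↦ by simp)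
  map_add' x y := by
    obtain ⟨f, rfl⟩ := mk_surjective x
    obtain ⟨g, rfl⟩ := mk_surjective y
    rw [← map_add]
    exact mk_eq_mk.2 (Filter.Eventually.of_forall fun i ↦ by simp)
  map_mul' x y := by
    obtain ⟨f, rfl⟩ := mk_surjective x
    obtain ⟨g, rfl⟩ := mk_surjective y
    rw [← map_mul]
    exact mk_eq_mk.2 (Filter.Eventually.of_forall fun i ↦ by simp)

theorem ultraMap_mk {M' : Type*} [Field M'] (j : M →+* M') (f : I → M) :
    ultraMap U j (mk U f) = mk U fun i ↦ j (f i) := rfl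

variable {U}

theorem exists_poly_lift {A B : Type*} [CommRing A] [CommRing B] [Nontrivial A] {f : A →+* B}
    (hf : Function.Surjective f) (p : B[X]) :
    ∃ q : A[X], q.map f = p ∧ q.natDegree = p.natDegree := by
  obtain ⟨q, hq, hd⟩ := exists_degree_eq_of_mem_lifts (f := f) (p := p)
    (by rw [lifts_iff_coeff_lifts]; exact fun n ↦ hf _)
  exact ⟨q, hq, natDegree_eq_of_degree_eq hd⟩

theorem eval_mk (q : (I → M)[X]) (f : I → M) :
    (q.map (mk U)).eval (mk U f) = mk U fun i ↦ (q.map (Pi.evalRingHom _ i)).eval (f i) := by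
  have h := hom_eval₂ q (RingHom.id _) (mk U) f
  rw [RingHom.comp_id] at h
  rw [eval_map, ← h]
  congr 1
  funext i
  have h' := hom_eval₂ q (RingHom.id _) (Pi.evalRingHom (fun _ ↦ M) i) f
  rw [RingHom.comp_id] at h'
  rw [eval_map]
  exact h'

instance [IsAlgClosed M] : IsAlgClosed (Ultrapower U M) := by
  refine IsAlgClosed.of_exists_root _ fun p hp hirr ↦ ?_
  have hd := hirr.natDegree_pos
  obtain ⟨q, rfl, hqd, hqm⟩ := lifts_and_natDegree_eq_and_monic (f := mk U (M := M)) (p := p)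
    (by rw [lifts_iff_coeff_lifts]; exact fun n ↦ mk_surjective _) hp
  have h (i : I) : ∃ y, (q.map (Pi.evalRingHom _ i)).eval y = 0 := by
    apply IsAlgClosed.exists_root
    rw [degree_eq_natDegree (hqm.map _).ne_zero, hqm.natDegree_map, hqd]
    exact_mod_cast hd.ne'
  choose y hy using h
  exact ⟨mk U y, by rw [eval_mk]; exact mk_eq_zero.2 (Filter.Eventually.of_forall hy)⟩

instance [CharZero M] : CharZero (Ultrapower U M) :=
  charZero_of_injective_ringHom (diag U (M := M)).injective

/-- An internal subfield of an ultrapower. -/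
def ultraSub (U : Ultrafilter I) (K : I → Subfield Ω) : Subfield (Ultrapower U Ω) where
  carrier := {x | ∃ f : I → Ω, (∀ i, f i ∈ K i) ∧ mk U f = x}
  mul_mem' := by
    rintro _ _ ⟨f, hf, rfl⟩ ⟨g, hg, rfl⟩
    exact ⟨f * g, fun i ↦ mul_mem (hf i) (hg i), map_mul _ _ _⟩
  one_mem' := ⟨1, fun i ↦ one_mem _, map_one _⟩
  add_mem' := by
    rintro _ _ ⟨f, hf, rfl⟩ ⟨g, hg, rfl⟩
    exact ⟨f + g, fun i ↦ add_mem (hf i) (hg i), map_add _ _ _⟩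
  zero_mem' := ⟨0, fun i ↦ zero_mem _, map_zero _⟩
  neg_mem' := by
    rintro _ ⟨f, hf, rfl⟩
    exact ⟨-f, fun i ↦ neg_mem (hf i), map_neg _ _⟩
  inv_mem' := by
    rintro _ ⟨f, hf, rfl⟩
    exact ⟨fun i ↦ (f i)⁻¹, fun i ↦ inv_mem (hf i), rfl⟩

theorem mk_mem_ultraSub {K : I → Subfield Ω} {f : I → Ω} :
    mk U f ∈ ultraSub U K ↔ ∀ᶠ i in (U : Filter I), f i ∈ K i := by
  classical
  constructor
  · rintro ⟨g, hg, h⟩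
    rw [mk_eq_mk] at h
    filter_upwards [h] with i hi
    rw [← hi]
    exact hg i
  · intro h
    refine ⟨fun i ↦ if f i ∈ K i then f i else 0, fun i ↦ ?_, ?_⟩
    · dsimp only
      split_ifs with hi
      exacts [hi, zero_mem _]
    · rw [mk_eq_mk]
      filter_upwards [h] with i hi
      rw [if_pos hi]

theorem ultraSub_mono {K L : I → Subfield Ω} (h : ∀ i, K i ≤ L i) :
    ultraSub U K ≤ ultraSub U L := by
  rintro _ ⟨f, hf, rfl⟩
  exact ⟨f, fun i ↦ h i (hf i), rfl⟩

theorem adjoin_le_ultraSub {k₀ : Subfield Ω} {k : Subfield (Ultrapower U Ω)}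
    (hk : k ≤ ultraSub U fun _ ↦ k₀) (θ : I → Ω) {x : Ultrapower U Ω} (hx : x ∈ k⟮mk U θ⟯) :
    x ∈ ultraSub U fun i ↦ (k₀⟮θ i⟯).toSubfield := by
  have : (k⟮mk U θ⟯).toSubfield ≤ ultraSub U fun i ↦ (k₀⟮θ i⟯).toSubfield := by
    change Subfield.closure _ ≤ _
    rw [Subfield.closure_le]
    rintro y (⟨a, rfl⟩ | rfl)
    · exact ultraSub_mono (fun i z hz ↦ (k₀⟮θ i⟯).algebraMap_mem ⟨z, hz⟩) (hk a.2)
    · exact ⟨θ, fun i ↦ mem_adjoin_simple_self k₀ (θ i), rfl⟩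
  exact this hx

theorem exists_degree_le {k₀ : Subfield Ω} {k : Subfield (Ultrapower U Ω)}
    (hk : k ≤ ultraSub U fun _ ↦ k₀) {θ : I → Ω} (hθ : IsAlgebraic k (mk U θ)) :
    ∃ d, ∀ᶠ i in (U : Filter I), IsAlgebraic k₀ (θ i) ∧ (minpoly k₀ (θ i)).natDegree ≤ d := by
  let g : (I → k₀) →+* Ultrapower U Ω :=
    (mk U).comp (RingHom.pi fun i ↦ k₀.subtype.comp (Pi.evalRingHom (fun _ ↦ k₀) i))
  have hm := minpoly.monic hθ.isIntegral
  obtain ⟨q, hq, hqd, hqm⟩ := lifts_and_natDegree_eq_and_monic (f := g)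
    (p := (minpoly k (mk U θ)).map k.subtype)
    (by
      rw [lifts_iff_coeff_lifts]
      intro n
      rw [coeff_map]
      obtain ⟨f, hf, h⟩ := hk ((minpoly k (mk U θ)).coeff n).2
      exact ⟨fun i ↦ ⟨f i, hf i⟩, h⟩) (hm.map _)
  have h0 : q.eval₂ g (mk U θ) = 0 := by
    rw [← eval_map, hq, eval_map]
    exact minpoly.aeval k (mk U θ)
  rw [← hom_eval₂, mk_eq_zero] at h0
  refine ⟨q.natDegree, ?_⟩
  filter_upwards [h0] with i hi
  have h1 : aeval (θ i) (q.map (Pi.evalRingHom (fun _ ↦ k₀) i)) = 0 := by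
    have h2 := hom_eval₂ q (RingHom.pi fun i ↦ k₀.subtype.comp (Pi.evalRingHom (fun _ ↦ k₀) i))
      (Pi.evalRingHom (fun _ ↦ Ω) i) θ
    rw [aeval_def, eval₂_map]
    exact h2.symm.trans hi
  have hqi := hqm.map (Pi.evalRingHom (fun _ ↦ k₀) i)
  refine ⟨⟨_, hqi.ne_zero, h1⟩, ?_⟩
  rw [← hqm.natDegree_map (Pi.evalRingHom (fun _ ↦ k₀) i)]
  exact natDegree_le_of_dvd (minpoly.dvd _ _ h1) hqi.ne_zero

theorem mem_adjoin_of_mem_ultraSub [CharZero Ω] {k₀ : Subfield Ω} {k : Subfield (Ultrapower U Ω)}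
    (hk : k ≤ ultraSub U fun _ ↦ k₀) (hr : RelClosed k (ultraSub U fun _ ↦ k₀)) {θ : I → Ω}
    (hθ : IsAlgebraic k (mk U θ)) {α : Ultrapower U Ω} (hα : IsAlgebraic k α)
    (hmem : α ∈ ultraSub U fun i ↦ (k₀⟮θ i⟯).toSubfield) : α ∈ k⟮mk U θ⟯ := by
  refine hr.mem_adjoin hk hθ hα ?_
  obtain ⟨α, hα', rfl⟩ := hmem
  obtain ⟨d, hd⟩ := exists_degree_le hk hθ
  have h (i : I) : ∃ p : Polynomial k₀,
      (IsAlgebraic k₀ (θ i) ∧ (minpoly k₀ (θ i)).natDegree ≤ d) →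
        p.natDegree < d ∧ aeval (θ i) p = α i := by
    by_cases hi : IsAlgebraic k₀ (θ i) ∧ (minpoly k₀ (θ i)).natDegree ≤ d
    · obtain ⟨p, hp, h⟩ := exists_poly_of_mem_adjoin hi.1 (hα' i)
      exact ⟨p, fun _ ↦ ⟨hp.trans_le hi.2, h⟩⟩
    · exact ⟨0, fun h ↦ absurd h hi⟩
  choose p hp using h
  have hsum : mk U α = ∑ j ∈ Finset.range d, mk U (fun i ↦ ((p i).coeff j : Ω)) * mk U θ ^ j := by
    simp only [← map_pow, ← map_mul, ← map_sum]
    rw [mk_eq_mk]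
    filter_upwards [hd] with i hi
    obtain ⟨h1, h2⟩ := hp i hi
    rw [← h2, aeval_eq_sum_range' h1]
    simp [Subfield.smul_def]
  rw [hsum]
  refine sum_mem fun j _ ↦ mul_mem ?_ (pow_mem (mem_adjoin_simple_self _ _) _)
  exact IntermediateField.algebraMap_mem _
    (⟨_, ⟨_, fun i ↦ ((p i).coeff j).2, rfl⟩⟩ : ultraSub U fun _ ↦ k₀)

end Ultrapower

theorem exists_integral_multiple_of_closure {R : Type*} [CommRing R] [IsDomain R] {h : R →+* Ω}
    {α : Ω} (hα : IsAlgebraic (Subfield.closure (Set.range h)) α) :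
    ∃ c : R, c ≠ 0 ∧ ∃ P : R[X], P.Monic ∧ P.eval₂ h (h c * α) = 0 := by
  let k := Subfield.closure (Set.range h)
  have hk (r : R) : h r ∈ k := Subfield.subset_closure ⟨r, rfl⟩
  let _ : Algebra R Ω := h.toAlgebra
  let _ : Algebra R k := (h.codRestrict k hk).toAlgebra
  have : IsScalarTower R k Ω := IsScalarTower.of_algebraMap_eq fun _ ↦ rfl
  have : Algebra.IsAlgebraic R k := by
    refine ⟨fun ⟨x, hx⟩ ↦ ?_⟩
    obtain ⟨y, hy, z, hz, rfl⟩ := Subfield.mem_closure_iff.1 hx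
    rw [← RingHom.coe_range, Subring.closure_eq] at hy hz
    obtain ⟨a, rfl⟩ := hy
    obtain ⟨b, rfl⟩ := hz
    rw [← isAlgebraic_algebraMap_iff (R := R) (A := Ω) (a := (⟨h a / h b, hx⟩ : k))
      Subtype.val_injective]
    change IsAlgebraic R (h a / h b)
    rw [div_eq_mul_inv]
    exact (isAlgebraic_algebraMap (R := R) (A := Ω) a).mul (isAlgebraic_algebraMap (A := Ω) b).inv
  obtain ⟨c, hc, P, hP, h0⟩ := (IsAlgebraic.restrictScalars R hα).exists_integral_multiple
  refine ⟨c, hc, P, hP, ?_⟩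
  rwa [Algebra.smul_def] at h0

/-- To check relative algebraic closedness of a fraction field it suffices to consider integral
elements. -/
theorem relClosed_closure_of_integral {R : Type*} [CommRing R] [IsDomain R] {h : R →+* Ω}
    (hinj : Function.Injective h) {K : Subfield Ω} (hK : ∀ r, h r ∈ K)
    (H : ∀ β ∈ K, ∀ P : R[X], P.Monic → P.eval₂ h β = 0 → β ∈ Set.range h) :
    RelClosed (Subfield.closure (Set.range h)) K := by
  intro α hα ha
  obtain ⟨c, hc, P, hP, h0⟩ := exists_integral_multiple_of_closure ha
  obtain ⟨r, hr⟩ := H _ (mul_mem (hK c) hα) P hP h0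
  have hc' : h c ≠ 0 := by rwa [Ne, map_eq_zero_iff h hinj]
  have : α = h r / h c := by rw [hr]; field_simp
  rw [this]
  exact div_mem (Subfield.subset_closure ⟨r, rfl⟩) (Subfield.subset_closure ⟨c, rfl⟩)

theorem mem_range_of_integral {R : Type*} [CommRing R] [IsDomain R] [IsIntegrallyClosed R]
    {h : R →+* Ω} (hinj : Function.Injective h) {β : Ω}
    (hβ : β ∈ Subfield.closure (Set.range h)) {P : R[X]} (hP : P.Monic) (h0 : P.eval₂ h β = 0) :
    β ∈ Set.range h := by
  obtain ⟨y, hy, z, hz, rfl⟩ := Subfield.mem_closure_iff.1 hβ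
  rw [← RingHom.coe_range, Subring.closure_eq] at hy hz
  obtain ⟨a, rfl⟩ := hy
  obtain ⟨b, rfl⟩ := hz
  let K := FractionRing R
  let φ : K →+* Ω := IsFractionRing.lift hinj
  have hφ (r : R) : φ (algebraMap R K r) = h r := IsFractionRing.lift_algebraMap hinj r
  have e : h a / h b = φ (algebraMap R K a / algebraMap R K b) := by
    rw [map_div₀, hφ, hφ]
  have h_integral : IsIntegral R (algebraMap R K a / algebraMap R K b) := by
    refine ⟨P, hP, φ.injective ?_⟩
    rw [hom_eval₂, map_zero, ← e, ← h0]
    congr 1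
    ext r
    exact hφ r
  obtain ⟨r, hr⟩ := IsIntegrallyClosed.isIntegral_iff.1 h_integral
  exact ⟨r, by rw [e, ← hr, hφ]⟩

/-- Evaluation of polynomials over a subfield. -/
def evalHom (E : Subfield Ω) (X : Ω) : Polynomial E →+* Ω := eval₂RingHom E.subtype X

theorem closure_range_evalHom (E : Subfield Ω) (x : Ω) :
    Subfield.closure (Set.range (evalHom E x)) = (E⟮x⟯).toSubfield := by
  apply le_antisymm
  · rw [Subfield.closure_le]
    rintro _ ⟨p, rfl⟩
    simp only [evalHom, coe_eval₂RingHom, eval₂_eq_sum_range]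
    exact sum_mem fun i _ ↦ mul_mem ((E⟮x⟯).algebraMap_mem _)
      (pow_mem (mem_adjoin_simple_self E x) _)
  · change Subfield.closure _ ≤ _
    rw [Subfield.closure_le]
    rintro y (⟨a, rfl⟩ | rfl)
    · exact Subfield.subset_closure ⟨C a, by simp [evalHom]; rfl⟩
    · exact Subfield.subset_closure ⟨X, by simp [evalHom]⟩

theorem evalHom_injective {E : Subfield Ω} {x : Ω} (hx : ¬ IsAlgebraic E x) :
    Function.Injective (evalHom E x) := by
  rw [injective_iff_map_eq_zero]
  intro p hp
  by_contra h0
  exact hx ⟨p, h0, hp⟩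

theorem RelClosed.adjoin_transcendental {E B : Subfield Ω} (h : E ≤ B) (hr : RelClosed E B) {x : Ω}
    (hx : ¬ IsAlgebraic B x) : RelClosed (E⟮x⟯).toSubfield (B⟮x⟯).toSubfield := by
  have hxE : ¬ IsAlgebraic E x := fun h' ↦ hx (isAlgebraic_mono h h')
  rw [← closure_range_evalHom E]
  let _ : Algebra E B := (Subfield.inclusion h).toAlgebra
  let _ : Algebra E[X] B[X] := Polynomial.algebra E B
  have hcomp (p : Polynomial E) : evalHom B x (p.map (algebraMap E B)) = evalHom E x p := by
    simp only [evalHom, coe_eval₂RingHom, eval₂_map]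
    rfl
  refine relClosed_closure_of_integral (evalHom_injective hxE) (fun p ↦ ?_) fun β hβ P hP h0 ↦ ?_
  · rw [← closure_range_evalHom B, ← hcomp]
    exact Subfield.subset_closure ⟨_, rfl⟩
  rw [← closure_range_evalHom B] at hβ
  have hPB : (P.map (mapRingHom (algebraMap E B))).eval₂ (evalHom B x) β = 0 := by
    rw [eval₂_map, ← h0]
    congr 1
    ext p
    · simp only [RingHom.comp_apply, coe_mapRingHom, hcomp]
    · simp [evalHom]
  obtain ⟨b, rfl⟩ := mem_range_of_integral (evalHom_injective hx) hβ (hP.map _) hPB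
  have hb : IsIntegral (Polynomial E) b := by
    refine ⟨P, hP, evalHom_injective hx ?_⟩
    rw [hom_eval₂, map_zero, ← hPB, eval₂_map]
    rfl
  rw [Polynomial.isIntegral_iff_isIntegral_coeff] at hb
  have hb' : b ∈ lifts (algebraMap E B) := by
    rw [lifts_iff_coeff_lifts]
    intro n
    obtain ⟨q, hq, h0⟩ := hb n
    refine ⟨⟨b.coeff n, hr _ (b.coeff n).2 ⟨q, hq.ne_zero, ?_⟩⟩, rfl⟩
    have := congrArg B.subtype h0
    rw [hom_eval₂, map_zero] at this
    exact this
  obtain ⟨e, rfl⟩ := hb'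
  exact ⟨e, (hcomp e).symm⟩

theorem natDegree_le_of_eval_eq_zero {k : Type*} [Field k] {Q : k[X][X]} (hQ : Q.Monic) {p : k[X]}
    (h : Q.eval p = 0) {D : ℕ} (hD : ∀ l, (Q.coeff l).natDegree ≤ D) : p.natDegree ≤ D := by
  by_contra! hlt
  have hn : Q.natDegree ≠ 0 := fun h0 ↦ by
    rw [hQ.natDegree_eq_zero.1 h0] at h
    simp at h
  obtain ⟨n, hn⟩ := Nat.exists_eq_succ_of_ne_zero hn
  have hp : p ≠ 0 := by
    rintro rfl
    simp at hlt
  rw [eval_eq_sum_range, Finset.sum_range_succ, hQ.coeff_natDegree, one_mul,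
    add_eq_zero_iff_neg_eq] at h
  have h1 : (p ^ Q.natDegree).natDegree = (n + 1) * p.natDegree := by
    rw [natDegree_pow, hn]
  have h2 : (-∑ i ∈ Finset.range Q.natDegree, Q.coeff i * p ^ i).natDegree
      ≤ D + n * p.natDegree := by
    rw [natDegree_neg]
    refine natDegree_sum_le_of_forall_le _ _ fun i hi ↦ natDegree_mul_le.trans ?_
    rw [natDegree_pow]
    rw [Finset.mem_range, hn] at hi
    exact add_le_add (hD i) (Nat.mul_le_mul_right _ (by omega))
  rw [h, h1] at h2
  nlinarith

section Ultrapower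

variable {I : Type*} (U : Ultrafilter I)

theorem not_isAlgebraic_ultraSub {k₀ : Subfield Ω} {x : Ω} (hx : ¬ IsAlgebraic k₀ x) :
    ¬ IsAlgebraic (ultraSub U fun _ ↦ k₀) (diag U x) := by
  intro h
  obtain ⟨d, hd⟩ := exists_degree_le le_rfl h
  obtain ⟨i, hi, -⟩ := hd.exists
  exact hx hi

theorem relClosed_ultraSub_adjoin {k₀ : Subfield Ω} {x : Ω} (hx : ¬ IsAlgebraic k₀ x) :
    RelClosed ((ultraSub U fun _ ↦ k₀)⟮diag U x⟯).toSubfield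
      (ultraSub U fun _ ↦ (k₀⟮x⟯).toSubfield) := by
  let A := ultraSub U fun _ : I ↦ k₀
  have hxA := not_isAlgebraic_ultraSub U hx
  rw [← closure_range_evalHom]
  refine relClosed_closure_of_integral (evalHom_injective hxA) (fun p ↦ ?_) fun β hβ P hP h0 ↦ ?_
  · have : evalHom A (diag U x) p ∈ (A⟮diag U x⟯).toSubfield := by
      rw [← closure_range_evalHom]
      exact Subfield.subset_closure ⟨p, rfl⟩
    exact adjoin_le_ultraSub le_rfl (fun _ ↦ x) this
  obtain ⟨b, hb, rfl⟩ := hβ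
  let γ : (I → k₀) →+* (I → Ω) :=
    RingHom.pi fun i ↦ k₀.subtype.comp (Pi.evalRingHom (fun _ ↦ k₀) i)
  let g : (I → k₀) →+* A := ((mk U).comp γ).codRestrict A fun f ↦ ⟨_, fun i ↦ (f i).2, rfl⟩
  have hg : Function.Surjective g := by
    rintro ⟨_, f, hf, rfl⟩
    exact ⟨fun i ↦ ⟨f i, hf i⟩, rfl⟩
  obtain ⟨Q, rfl, -, hQ⟩ := lifts_and_natDegree_eq_and_monic (f := mapRingHom g) (p := P)
    (by rw [lifts_iff_coeff_lifts]; exact fun n ↦ map_surjective g hg _) hP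
  let H : (I → k₀)[X] →+* (I → Ω) := eval₂RingHom γ (fun _ ↦ x)
  have hH : (evalHom A (diag U x)).comp (mapRingHom g) = (mk U).comp H := by
    ext p
    · simp [H, evalHom, g]
      rfl
    · simp [H, evalHom, diag_apply]
  rw [eval₂_map, hH, ← hom_eval₂, mk_eq_zero] at h0
  have hHi (i : I) : (Pi.evalRingHom (fun _ ↦ Ω) i).comp H =
      (evalHom k₀ x).comp (mapRingHom (Pi.evalRingHom (fun _ ↦ k₀) i)) := by
    ext p
    · simp [H, evalHom, γ]
    · simp [H, evalHom]
  let D := Q.support.sup fun l ↦ (Q.coeff l).natDegree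
  have key (i : I) : ∃ p : Polynomial k₀,
      Q.eval₂ H b i = 0 → p.natDegree ≤ D ∧ evalHom k₀ x p = b i := by
    by_cases hi : Q.eval₂ H b i = 0
    · have h1 := hom_eval₂ Q H (Pi.evalRingHom (fun _ ↦ Ω) i) b
      rw [hHi, ← eval₂_map] at h1
      have hQi := hQ.map (mapRingHom (Pi.evalRingHom (fun _ ↦ k₀) i))
      have hbi := hb i
      dsimp only at hbi
      rw [← closure_range_evalHom] at hbi
      obtain ⟨p, hp⟩ := mem_range_of_integral (evalHom_injective hx) hbi hQi (h1.symm.trans hi)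
      refine ⟨p, fun _ ↦ ⟨natDegree_le_of_eval_eq_zero hQi ?_ fun l ↦ ?_, hp⟩⟩
      · apply evalHom_injective hx
        rw [map_zero, ← eval₂_id, hom_eval₂, RingHom.comp_id, hp]
        exact h1.symm.trans hi
      · rw [coeff_map]
        refine (natDegree_map_le).trans ?_
        by_cases hl : l ∈ Q.support
        · exact Finset.le_sup (f := fun l ↦ (Q.coeff l).natDegree) hl
        · rw [notMem_support_iff.1 hl]
          simp
    · exact ⟨0, fun h ↦ absurd h hi⟩
  choose p hp using key
  refine ⟨∑ j ∈ Finset.range (D + 1), C (g fun i ↦ (p i).coeff j) * X ^ j, ?_⟩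
  have hsum : mk U b =
      ∑ j ∈ Finset.range (D + 1), mk U (fun i ↦ ((p i).coeff j : Ω)) * diag U x ^ j := by
    simp only [diag_apply, ← map_pow, ← map_mul, ← map_sum]
    rw [mk_eq_mk]
    filter_upwards [h0] with i hi
    obtain ⟨h1, h2⟩ := hp i hi
    rw [← h2, evalHom, coe_eval₂RingHom, eval₂_eq_sum_range' _ (Nat.lt_succ_of_le h1)]
    simp
  rw [hsum, map_sum]
  refine Finset.sum_congr rfl fun j _ ↦ ?_
  rw [map_mul, map_pow]
  simp only [evalHom, coe_eval₂RingHom, eval₂_C, eval₂_X]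
  rfl

end Ultrapower

section Hilbert

/-- The index type of the basic sets of the filter of Hilbertian specializations. -/
def HilbertIndex : Type := {P : ℤ[X][X] // P.Monic ∧ ∀ y, P.eval y ≠ 0} × ℤ

/-- The integers at least `N` at which the specialization of a polynomial has no root. -/
def hilbertSet (s : HilbertIndex) : Set ℤ := {t | s.2 ≤ t ∧ ∀ y : ℤ, s.1.1.evalEval t y ≠ 0}

theorem exists_ultrafilter_hilbertSet : ∃ U : Ultrafilter ℤ, ∀ s, hilbertSet s ∈ U := by
  have hne : Nonempty HilbertIndex := ⟨⟨1, monic_one, by simp⟩, 0⟩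
  have : (⨅ s, Filter.principal (hilbertSet s)).NeBot := by
    apply Filter.iInf_neBot_of_directed
    · rintro ⟨⟨P, hP, hP'⟩, N⟩ ⟨⟨Q, hQ, hQ'⟩, N'⟩
      refine ⟨⟨⟨P * Q, hP.mul hQ, fun y ↦ ?_⟩, max N N'⟩, ?_, ?_⟩
      · rw [eval_mul]
        exact mul_ne_zero (hP' y) (hQ' y)
      all_goals
        simp only [ge_iff_le, Filter.le_principal_iff, Filter.mem_principal]
        intro t ht
        refine ⟨by have := ht.1; simp at this; tauto, fun y h0 ↦ ht.2 y ?_⟩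
        simp [evalEval, eval_mul] at h0 ⊢
        tauto
    · rintro ⟨⟨P, hP, hP'⟩, N⟩
      rw [Filter.principal_neBot_iff]
      obtain ⟨t, ht, h⟩ := Hit.exists_specialization_no_root hP hP' N
      exact ⟨t, ht, h⟩
  exact ⟨Ultrafilter.of _, fun s ↦ Ultrafilter.of_le _
    (Filter.mem_iInf_of_mem s (Filter.mem_principal_self _))⟩

theorem eventually_eval_intCast_ne_zero [CharZero Ω] {U : Ultrafilter ℤ}
    (hU : ∀ s, hilbertSet s ∈ U) {p : Polynomial Ω} (hp : p ≠ 0) :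
    ∀ᶠ n : ℤ in (U : Filter ℤ), p.eval (n : Ω) ≠ 0 := by
  have hfin : {n : ℤ | p.eval (n : Ω) = 0}.Finite :=
    (p.finite_setOfPred_isRoot hp).preimage Int.cast_injective.injOn
  obtain ⟨N, hN⟩ := hfin.bddAbove
  have := hU ⟨⟨1, monic_one, by simp⟩, N + 1⟩
  filter_upwards [this] with n hn h0
  have h1 := hN h0
  have h2 := hn.1
  simp only at h2
  omega

theorem relClosed_closure_intCast [CharZero Ω] {U : Ultrafilter ℤ}
    (hU : ∀ s, hilbertSet s ∈ U) :
    RelClosed (Subfield.closure {mk U fun n : ℤ ↦ (n : Ω)}) (ultraSub U fun _ ↦ ⊥) := by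
  let H : ℤ[X] →+* (ℤ → Ω) := eval₂RingHom (Int.castRingHom _) fun n : ℤ ↦ (n : Ω)
  let h : ℤ[X] →+* Ultrapower U Ω := (mk U).comp H
  have hH (n : ℤ) : (Pi.evalRingHom (fun _ ↦ Ω) n).comp H =
      (Int.castRingHom Ω).comp (evalRingHom n) := by
    refine ringHom_ext (fun a ↦ by simp) ?_
    simp only [H, RingHom.comp_apply, coe_eval₂RingHom, eval₂_X, coe_evalRingHom, eval_X,
      Pi.evalRingHom_apply, eq_intCast]
  have hH' (p : ℤ[X]) (n : ℤ) : H p n = (p.eval n : ℤ) := congrArg (· p) (hH n)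
  have hinj : Function.Injective h := by
    rw [injective_iff_map_eq_zero]
    intro p hp
    by_contra h0
    have h1 := eventually_eval_intCast_ne_zero (Ω := Ω) hU (p := p.map (Int.castRingHom Ω))
      (by rwa [Polynomial.map_ne_zero_iff (RingHom.injective_int _)])
    obtain ⟨n, h2, h3⟩ := ((mk_eq_zero.1 hp).and h1).exists
    rw [hH'] at h2
    rw [eval_intCast_map] at h3
    exact h3 h2
  have hcl : Subfield.closure {mk U fun n : ℤ ↦ (n : Ω)} = Subfield.closure (Set.range h) := by
    apply le_antisymm
    · rw [Subfield.closure_le, Set.singleton_subset_iff]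
      exact Subfield.subset_closure ⟨X, by simp [h, H]⟩
    · rw [Subfield.closure_le]
      rintro _ ⟨p, rfl⟩
      have hp : h p = _ := hom_eval₂ p (Int.castRingHom _) (mk U) fun n : ℤ ↦ (n : Ω)
      rw [hp, eval₂_eq_sum_range]
      refine sum_mem fun i _ ↦ mul_mem ?_ (pow_mem
        (Subfield.subset_closure (Set.mem_singleton _)) _)
      rw [eq_intCast]
      exact intCast_mem _ _
  rw [hcl]
  refine relClosed_closure_of_integral hinj (fun p ↦ ?_) ?_
  · refine ⟨H p, fun n ↦ ?_, rfl⟩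
    rw [hH']
    exact intCast_mem _ _
  rintro _ ⟨b, hb, rfl⟩ P hP h0
  obtain ⟨d, hd⟩ : ∃ d, P.natDegree = d := ⟨_, rfl⟩
  induction d generalizing P with
  | zero =>
    rw [hP.natDegree_eq_zero.1 hd] at h0
    simp at h0
  | succ d ih =>
    by_cases hr : ∃ r, P.eval r = 0
    · obtain ⟨r, hr⟩ := hr
      obtain ⟨Q, rfl⟩ := dvd_iff_isRoot.2 hr
      have hQ : Q.Monic := (monic_X_sub_C r).of_mul_monic_left hP
      rw [eval₂_mul, mul_eq_zero] at h0
      rcases h0 with h0 | h0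
      · rw [eval₂_sub, eval₂_X, eval₂_C, sub_eq_zero] at h0
        exact ⟨r, h0.symm⟩
      · refine ih Q hQ h0 ?_
        rw [(monic_X_sub_C r).natDegree_mul hQ, natDegree_X_sub_C] at hd
        omega
    · push Not at hr
      exfalso
      rw [← hom_eval₂, mk_eq_zero] at h0
      obtain ⟨n, h1, h2⟩ := (h0.and (hU ⟨⟨P, hP, hr⟩, 0⟩)).exists
      have h3 := hom_eval₂ P H (Pi.evalRingHom (fun _ ↦ Ω) n) b
      rw [hH, ← eval₂_map] at h3
      have h4 := h3.symm.trans h1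
      obtain ⟨y, hy⟩ := mem_range_of_integral (RingHom.injective_int (Int.castRingHom Ω))
        ((bot_le : (⊥ : Subfield Ω) ≤ _) (hb n)) (hP.map _) h4
      apply h2.2 y
      rw [Pi.evalRingHom_apply, ← hy, eval₂_at_apply, map_evalRingHom_eval] at h4
      exact (map_eq_zero_iff _ (RingHom.injective_int (Int.castRingHom Ω))).1 h4

theorem not_isAlgebraic_mk_intCast [CharZero Ω] {U : Ultrafilter ℤ} (hU : ∀ s, hilbertSet s ∈ U) :
    ¬ IsAlgebraic (diag U (M := Ω)).fieldRange (mk U fun n : ℤ ↦ (n : Ω)) := by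
  rw [isAlgebraic_iff_subfield]
  rintro ⟨p, hp, hc, h0⟩
  obtain ⟨q, rfl⟩ : p ∈ lifts (diag U (M := Ω)) := by
    rw [lifts_iff_coeff_lifts]
    exact hc
  have hq : q ≠ 0 := by
    rintro rfl
    simp at hp
  rw [coe_mapRingHom, diag, ← Polynomial.map_map, eval_mk, mk_eq_zero] at h0
  obtain ⟨n, h1, h2⟩ := (h0.and (eventually_eval_intCast_ne_zero hU hq)).exists
  rw [Polynomial.map_map] at h1
  apply h2
  rw [← h1]
  exact congrArg _ (Polynomial.map_id.symm)

end Hilbert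

section Curves

theorem isAlgebraic_trans {k L : Subfield Ω} (h : k ≤ L) (halg : ∀ y ∈ L, IsAlgebraic k y) {x : Ω}
    (hx : IsAlgebraic L x) : IsAlgebraic k x := by
  let _ : Algebra k L := (Subfield.inclusion h).toAlgebra
  have : IsScalarTower k L Ω := IsScalarTower.of_algebraMap_eq fun _ ↦ rfl
  have : Algebra.IsAlgebraic k L := ⟨fun y ↦ by
    rw [← isAlgebraic_algebraMap_iff (A := Ω) (algebraMap L Ω).injective]
    exact halg _ y.2⟩
  exact hx.restrictScalars k

/-- The subfield generated by a subfield and an element. -/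
abbrev adj (k : Subfield Ω) (x : Ω) : Subfield Ω := (k⟮x⟯).toSubfield

theorem le_adj (k : Subfield Ω) (x : Ω) : k ≤ adj k x := fun y hy ↦
  (k⟮x⟯).algebraMap_mem ⟨y, hy⟩

theorem mem_adj (k : Subfield Ω) (x : Ω) : x ∈ adj k x := mem_adjoin_simple_self k x

theorem adj_le {k K : Subfield Ω} {x : Ω} (h : k ≤ K) (hx : x ∈ K) : adj k x ≤ K := by
  change Subfield.closure _ ≤ _
  rw [Subfield.closure_le]
  rintro y (⟨a, rfl⟩ | rfl)
  exacts [h a.2, hx]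

variable {N : Type*} [Field N]

theorem map_adj (e : N →+* Ω) (k : Subfield N) (x : N) :
    (adj k x).map e = adj (k.map e) (e x) := by
  apply le_antisymm
  · rw [Subfield.map_le_iff_le_comap]
    exact adj_le (fun y hy ↦ le_adj _ _ ⟨y, hy, rfl⟩) (mem_adj (k.map e) (e x))
  · exact adj_le ((Subfield.gc_map_comap e).monotone_l (le_adj k x)) ⟨x, mem_adj k x, rfl⟩

theorem isAlgebraic_map_iff (e : N →+* Ω) {k : Subfield N} {x : N} :
    IsAlgebraic (k.map e) (e x) ↔ IsAlgebraic k x := by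
  let f : k →+* k.map e := (e.comp k.subtype).codRestrict _ fun y ↦ ⟨y, y.2, rfl⟩
  constructor
  · intro h
    refine h.of_ringHom_of_comp_eq f e ?_ e.injective rfl
    rintro ⟨_, y, hy, rfl⟩
    exact ⟨⟨y, hy⟩, rfl⟩
  · exact fun h ↦ h.ringHom_of_comp_eq f e f.injective rfl

theorem relClosed_map_iff (e : N →+* Ω) {k K : Subfield N} :
    RelClosed (k.map e) (K.map e) ↔ RelClosed k K := by
  constructor
  · intro h x hx ha
    obtain ⟨y, hy, hxy⟩ := h (e x) ⟨x, hx, rfl⟩ ((isAlgebraic_map_iff e).2 ha)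
    rwa [← e.injective hxy]
  · rintro h _ ⟨x, hx, rfl⟩ ha
    exact ⟨x, h x hx ((isAlgebraic_map_iff e).1 ha), rfl⟩

/-- `K` is a regular extension of `k` of transcendence degree one with transcendence base `x`. -/
structure IsCurveIn (k K : Subfield Ω) (x : Ω) : Prop where
  le : k ≤ K
  relClosed : RelClosed k K
  mem : x ∈ K
  not_isAlgebraic : ¬ IsAlgebraic k x
  isAlgebraic : ∀ y ∈ K, IsAlgebraic (adj k x) y

theorem isCurveIn_map_iff (e : N →+* Ω) {k K : Subfield N} {x : N} :
    IsCurveIn (k.map e) (K.map e) (e x) ↔ IsCurveIn k K x := by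
  constructor
  · rintro ⟨h1, h2, h3, h4, h5⟩
    refine ⟨fun y hy ↦ ?_, (relClosed_map_iff e).1 h2, ?_, fun h ↦ h4 ((isAlgebraic_map_iff e).2 h),
      fun y hy ↦ ?_⟩
    · obtain ⟨z, hz, h⟩ := h1 ⟨y, hy, rfl⟩
      rwa [← e.injective h]
    · obtain ⟨z, hz, h⟩ := h3
      rwa [← e.injective h]
    · rw [← isAlgebraic_map_iff e, map_adj]
      exact h5 _ ⟨y, hy, rfl⟩
  · rintro ⟨h1, h2, h3, h4, h5⟩
    refine ⟨(Subfield.gc_map_comap e).monotone_l h1, (relClosed_map_iff e).2 h2, ⟨x, h3, rfl⟩,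
      fun h ↦ h4 ((isAlgebraic_map_iff e).1 h), ?_⟩
    rintro _ ⟨y, hy, rfl⟩
    rw [← map_adj, isAlgebraic_map_iff]
    exact h5 y hy

variable {M : Type*} [Field M]

/-- `N` is, via `i`, a regular extension of `M` of transcendence degree one. -/
def IsCurve (i : M →+* N) (x : N) : Prop := IsCurveIn i.fieldRange ⊤ x

/-- The image of `i` is relatively algebraically closed. -/
def RACHom (i : M →+* N) : Prop := RelClosed i.fieldRange ⊤

theorem isCurve_iff_comp (e : N →+* Ω) {i : M →+* N} {x : N} :
    IsCurve i x ↔ IsCurveIn (e.comp i).fieldRange e.fieldRange (e x) := by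
  rw [IsCurve, ← isCurveIn_map_iff e, RingHom.map_fieldRange, ← RingHom.fieldRange_eq_map]

theorem racHom_iff_comp (e : N →+* Ω) {i : M →+* N} :
    RACHom i ↔ RelClosed (e.comp i).fieldRange e.fieldRange := by
  rw [RACHom, ← relClosed_map_iff e, RingHom.map_fieldRange, ← RingHom.fieldRange_eq_map]

theorem closure_range_eval₂RingHom (i : M →+* Ω) (x : Ω) :
    Subfield.closure (Set.range (eval₂RingHom i x)) = adj i.fieldRange x := by
  apply le_antisymm
  · rw [Subfield.closure_le]
    rintro _ ⟨p, rfl⟩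
    simp only [coe_eval₂RingHom, eval₂_eq_sum_range]
    exact sum_mem fun j _ ↦ mul_mem (le_adj _ _ ⟨_, rfl⟩) (pow_mem (mem_adj i.fieldRange x) _)
  · apply adj_le
    · rintro _ ⟨a, rfl⟩
      exact Subfield.subset_closure ⟨C a, by simp⟩
    · exact Subfield.subset_closure ⟨X, by simp⟩

theorem eval₂RingHom_injective {i : M →+* Ω} {x : Ω} (hx : ¬ IsAlgebraic i.fieldRange x) :
    Function.Injective (eval₂RingHom i x) := by
  rw [injective_iff_map_eq_zero]
  intro p hp
  by_contra h0
  refine hx (isAlgebraic_iff_subfield.2 ⟨p.map i, ?_, fun n ↦ ?_, ?_⟩)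
  · rwa [Polynomial.map_ne_zero_iff i.injective]
  · rw [coeff_map]
    exact ⟨_, rfl⟩
  · rwa [eval_map]

/-- An extension of transcendence degree one embeds into an algebraically closed field as soon as
the base and a transcendence base do. -/
theorem exists_embedding [IsAlgClosed Ω] {i : M →+* N} {x : N} (hx : ¬ IsAlgebraic i.fieldRange x)
    (halg : ∀ y : N, IsAlgebraic (adj i.fieldRange x) y) {j : M →+* Ω} {y : Ω}
    (hy : ¬ IsAlgebraic j.fieldRange y) : ∃ e : N →+* Ω, e.comp i = j ∧ e x = y := by
  let _ : Algebra M[X] N := (eval₂RingHom i x).toAlgebra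
  let _ : Algebra M[X] Ω := (eval₂RingHom j y).toAlgebra
  have h1 : Module.IsTorsionFree M[X] N :=
    Module.isTorsionFree_iff_algebraMap_injective.2 (eval₂RingHom_injective hx)
  have h2 : Module.IsTorsionFree M[X] Ω :=
    Module.isTorsionFree_iff_algebraMap_injective.2 (eval₂RingHom_injective hy)
  have h3 : Algebra.IsAlgebraic M[X] N := by
    refine ⟨fun z ↦ ?_⟩
    have hz := halg z
    rw [← closure_range_eval₂RingHom] at hz
    obtain ⟨c, hc, P, hP, h0⟩ := exists_integral_multiple_of_closure hz
    exact IsAlgebraic.iff_exists_smul_integral.2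
      ⟨c, hc, P, hP, by rw [Algebra.smul_def]; exact h0⟩
  let e : N →ₐ[M[X]] Ω := IsAlgClosed.lift
  have he (p : M[X]) : e (eval₂RingHom i x p) = eval₂RingHom j y p := e.commutes p
  refine ⟨e, ?_, ?_⟩
  · ext a
    simpa using he (C a)
  · simpa using he X

theorem exists_transcendental_extension (M : Type*) [Field M] :
    ¬ IsAlgebraic (algebraMap M (AlgebraicClosure (RatFunc M))).fieldRange
      (algebraMap (RatFunc M) (AlgebraicClosure (RatFunc M)) RatFunc.X) := by
  rw [IsScalarTower.algebraMap_eq M (RatFunc M), ← RingHom.map_fieldRange, isAlgebraic_map_iff]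
  intro h
  refine RatFunc.transcendental_X (K := M) ?_
  rw [isAlgebraic_iff_subfield] at h
  obtain ⟨p, hp, hc, h0⟩ := h
  obtain ⟨q, rfl⟩ : p ∈ lifts (algebraMap M (RatFunc M)) := by
    rw [lifts_iff_coeff_lifts]
    exact hc
  refine ⟨q, ?_, ?_⟩
  · rintro rfl
    simp at hp
  · rwa [coe_mapRingHom, eval_map_algebraMap] at h0

theorem relClosed_adj {k : Subfield Ω} {x : Ω} (hx : ¬ IsAlgebraic k x) :
    RelClosed k (adj k x) := by
  intro β hβ ha
  have hm := minpoly.monic ha.isIntegral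
  have h0 : ((minpoly k β).map C).eval₂ (evalHom k x) β = 0 := by
    rw [eval₂_map]
    have : (evalHom k x).comp C = algebraMap k Ω := by
      ext a
      simp only [evalHom, RingHom.comp_apply, coe_eval₂RingHom, eval₂_C]
      rfl
    rw [this]
    exact minpoly.aeval k β
  rw [adj, ← closure_range_evalHom] at hβ
  obtain ⟨p, rfl⟩ := mem_range_of_integral (evalHom_injective hx) hβ (hm.map C) h0
  have hp : p.natDegree ≤ 0 := by
    refine natDegree_le_of_eval_eq_zero (hm.map C) (evalHom_injective hx ?_) fun l ↦ by simp
    rw [map_zero, ← h0, ← eval₂_id, hom_eval₂, RingHom.comp_id]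
  rw [eq_C_of_natDegree_le_zero hp]
  simp [evalHom]

end Curves

section Specialization

variable {I : Type*} {U : Ultrafilter I}

/-- Finitely many elements of an algebraic extension inside an ultrapower are coordinatewise
contained in simple extensions whose internal ultraproduct has only trivial algebraic elements. -/
theorem exists_specialization [CharZero Ω] {k₀ : Subfield Ω} {k L : Subfield (Ultrapower U Ω)}
    (hk : k ≤ ultraSub U fun _ ↦ k₀) (hr : RelClosed k (ultraSub U fun _ ↦ k₀)) (hkL : k ≤ L)
    (halg : ∀ y ∈ L, IsAlgebraic k y) {S : Set (Ultrapower U Ω)} (hS : S.Finite)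
    (hSL : S ⊆ L) : ∃ θ : I → Ω, IsAlgebraic k (mk U θ) ∧
      (S ⊆ (ultraSub U fun i ↦ adj k₀ (θ i))) ∧
      ∀ α ∈ ultraSub U (fun i ↦ adj k₀ (θ i)), IsAlgebraic k α → α ∈ L := by
  obtain ⟨γ, hγ, hadj⟩ := exists_primitive hS fun x hx ↦ halg x (hSL hx)
  obtain ⟨θ, rfl⟩ := mk_surjective γ
  refine ⟨θ, hγ, fun x hx ↦ ?_, fun α hα ha ↦ ?_⟩
  · apply adjoin_le_ultraSub hk
    rw [← hadj]
    exact subset_adjoin _ _ hx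
  · have h1 : α ∈ adjoin k S := by
      rw [hadj]
      exact mem_adjoin_of_mem_ultraSub hk hr hγ ha hα
    have h2 : (adjoin k S).toSubfield ≤ L := by
      change Subfield.closure _ ≤ _
      rw [Subfield.closure_le]
      rintro y (⟨a, rfl⟩ | hy)
      exacts [hkL a.2, hSL hy]
    exact h2 h1

end Specialization

section Systems

variable {σ : Type*}

/-- Evaluation of integral polynomials. -/
def ev {R : Type*} [CommRing R] (w : σ → R) : MvPolynomial σ ℤ →+* R :=
  MvPolynomial.eval₂Hom (Int.castRingHom R) w

theorem comp_ev {R S : Type*} [CommRing R] [CommRing S] (φ : R →+* S) (w : σ → R) :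
    φ.comp (ev w) = ev (φ ∘ w) := by
  refine MvPolynomial.ringHom_ext (fun a ↦ by simp [ev]) fun s ↦ by simp [ev]

theorem apply_ev {R S : Type*} [CommRing R] [CommRing S] (φ : R →+* S) (w : σ → R)
    (p : MvPolynomial σ ℤ) : φ (ev w p) = ev (φ ∘ w) p :=
  congrArg (· p) (comp_ev φ w)

theorem apply_eval₂_ev {R S : Type*} [CommRing R] [CommRing S] (φ : R →+* S) (w : σ → R) (y : R)
    (f : (MvPolynomial σ ℤ)[X]) : φ (f.eval₂ (ev w) y) = f.eval₂ (ev (φ ∘ w)) (φ y) := by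
  rw [hom_eval₂, comp_ev]

/-- `w` is a common zero of `G` such that `f`, specialized at `w`, has no root in `K`. -/
def Solves {R : Type*} [CommRing R] (K : Set R) (G : Finset (MvPolynomial σ ℤ))
    (f : (MvPolynomial σ ℤ)[X]) (w : σ → R) : Prop :=
  (∀ g ∈ G, ev w g = 0) ∧ ∀ y ∈ K, f.eval₂ (ev w) y ≠ 0

variable {G : Finset (MvPolynomial σ ℤ)} {f : (MvPolynomial σ ℤ)[X]}

theorem solves_image_iff {R S : Type*} [CommRing R] [CommRing S] {φ : R →+* S}
    (hφ : Function.Injective φ) {K : Set R} {w : σ → R} :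
    Solves (φ '' K) G f (φ ∘ w) ↔ Solves K G f w := by
  simp only [Solves, ← apply_ev, Set.forall_mem_image, ← apply_eval₂_ev, map_eq_zero_iff φ hφ, Ne]

theorem Solves.of_isAlgebraic {L : Subfield Ω} {K : Set Ω} {w : σ → Ω} (hw : ∀ s, w s ∈ L)
    (h : Solves (L : Set Ω) G f w) (hK : ∀ α ∈ K, IsAlgebraic L α → α ∈ L) : Solves K G f w := by
  refine ⟨h.1, fun y hy h0 ↦ h.2 y (hK y hy
    (isAlgebraic_iff_subfield.2 ⟨f.map (ev w), ?_, ?_, ?_⟩)) h0⟩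
  · intro hf
    refine h.2 0 (zero_mem L) ?_
    rw [← eval_map, hf, eval_zero]
  · intro n
    rw [coeff_map]
    have : w = L.subtype ∘ fun s ↦ ⟨w s, hw s⟩ := rfl
    rw [this, ← apply_ev]
    exact Subtype.prop _
  · rwa [eval_map]

variable {I : Type*} {U : Ultrafilter I}

theorem ev_mk {M : Type*} [Field M] (w : I → σ → M) (p : MvPolynomial σ ℤ) :
    ev (fun s ↦ mk U fun i ↦ w i s) p = mk U fun i ↦ ev (w i) p := by
  have h := apply_ev (mk U) (fun s i ↦ w i s) p
  refine h.symm.trans (congrArg _ (funext fun i ↦ ?_))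
  exact apply_ev (Pi.evalRingHom (fun _ ↦ M) i) _ p

theorem eval₂_ev_mk {M : Type*} [Field M] (w : I → σ → M) (y : I → M) :
    f.eval₂ (ev fun s ↦ mk U fun i ↦ w i s) (mk U y) = mk U fun i ↦ f.eval₂ (ev (w i)) (y i) := by
  have h := apply_eval₂_ev (mk U) (fun s i ↦ w i s) y f
  refine h.symm.trans (congrArg _ (funext fun i ↦ ?_))
  exact apply_eval₂_ev (Pi.evalRingHom (fun _ ↦ M) i) _ y f

theorem solves_ultraSub_iff {w : I → σ → Ω} {K : I → Subfield Ω} :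
    Solves (ultraSub U K : Set (Ultrapower U Ω)) G f (fun s ↦ mk U fun i ↦ w i s) ↔
      ∀ᶠ i in (U : Filter I), Solves (K i : Set Ω) G f (w i) := by
  simp only [Solves, Filter.eventually_and, Filter.eventually_all_finset, ev_mk, mk_eq_zero]
  refine and_congr_right fun _ ↦ ⟨fun h ↦ ?_, ?_⟩
  · by_contra hc
    rw [← Ultrafilter.eventually_not] at hc
    simp only [not_forall, not_not] at hc
    obtain ⟨y, hy⟩ := hc.choice
    refine h (mk U y) (mk_mem_ultraSub.2 (hy.mono fun i hi ↦ hi.1)) ?_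
    rw [eval₂_ev_mk, mk_eq_zero]
    exact hy.mono fun i hi ↦ hi.2
  · rintro h _ ⟨y, hy, rfl⟩ h0
    rw [eval₂_ev_mk, mk_eq_zero] at h0
    obtain ⟨i, h1, h2⟩ := (h.and h0).exists
    exact h1 _ (hy i) h2

theorem ultraSub_top : (ultraSub U fun _ ↦ ⊤ : Subfield (Ultrapower U Ω)) = ⊤ := by
  rw [eq_top_iff]
  rintro x -
  obtain ⟨f, rfl⟩ := mk_surjective x
  exact ⟨f, fun _ ↦ trivial, rfl⟩

theorem fieldRange_ultraMap {M : Type*} [Field M] (j : M →+* Ω) :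
    (ultraMap U j).fieldRange = ultraSub U fun _ ↦ j.fieldRange := by
  ext x
  constructor
  · rintro ⟨a, rfl⟩
    obtain ⟨a, rfl⟩ := mk_surjective a
    exact ⟨fun i ↦ j (a i), fun i ↦ ⟨_, rfl⟩, rfl⟩
  · rintro ⟨b, hb, rfl⟩
    choose a ha using hb
    exact ⟨mk U a, by rw [ultraMap_mk]; simp only [ha]⟩

end Systems

section DegreeBounds

variable {I : Type*} {U : Ultrafilter I}

theorem isAlgebraic_mk {k₀ : Subfield Ω} {α : I → Ω} {d : ℕ} (h : ∀ᶠ i in (U : Filter I),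
    IsAlgebraic k₀ (α i) ∧ (minpoly k₀ (α i)).natDegree ≤ d) :
    IsAlgebraic (ultraSub U fun _ ↦ k₀) (mk U α) := by
  let q (i : I) : Polynomial k₀ := minpoly k₀ (α i) * X ^ (d - (minpoly k₀ (α i)).natDegree)
  let c (j : ℕ) : ultraSub U fun _ ↦ k₀ :=
    ⟨mk U fun i ↦ ((q i).coeff j : Ω), fun i ↦ ((q i).coeff j : Ω), fun i ↦ Subtype.prop _, rfl⟩
  have hq : ∀ᶠ i in (U : Filter I), (q i).natDegree = d ∧ (q i).Monic ∧ aeval (α i) (q i) = 0 := by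
    filter_upwards [h] with i hi
    have hm := minpoly.monic hi.1.isIntegral
    refine ⟨?_, hm.mul (monic_X_pow _), by simp [q]⟩
    rw [hm.natDegree_mul (monic_X_pow _), natDegree_X_pow]
    omega
  refine ⟨∑ j ∈ Finset.range (d + 1), C (c j) * X ^ j, ?_, ?_⟩
  · intro h0
    have h1 := congrArg (coeff · d) h0
    simp only [finsetSum_coeff, coeff_C_mul_X_pow, coeff_zero] at h1
    rw [Finset.sum_ite_eq, if_pos (Finset.self_mem_range_succ d)] at h1
    have h2 : mk U (fun i ↦ ((q i).coeff d : Ω)) = 0 := congrArg Subtype.val h1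
    rw [mk_eq_zero] at h2
    obtain ⟨i, h3, h4, h5, -⟩ := (h2.and hq).exists
    rw [← h4, h5.coeff_natDegree] at h3
    simp at h3
  · rw [map_sum]
    have : ∑ j ∈ Finset.range (d + 1), aeval (mk U α) (C (c j) * X ^ j) =
        mk U fun i ↦ aeval (α i) (q i) := by
      have h2 (j : ℕ) : aeval (mk U α) (C (c j) * X ^ j) =
          mk U ((fun i ↦ ((q i).coeff j : Ω)) * α ^ j) := by
        rw [map_mul, map_pow, aeval_C, aeval_X, map_mul, map_pow]
        rfl
      simp only [h2, ← map_sum]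
      rw [mk_eq_mk]
      filter_upwards [hq] with i hi
      rw [aeval_eq_sum_range, hi.1]
      simp [Subfield.smul_def]
    rw [this, mk_eq_zero]
    exact hq.mono fun i hi ↦ hi.2.2

theorem natDegree_minpoly_le {k : Subfield Ω} {θ α : Ω} (hθ : IsAlgebraic k θ) (hα : α ∈ adj k θ) :
    IsAlgebraic k α ∧ (minpoly k α).natDegree ≤ (minpoly k θ).natDegree := by
  have := adjoin.finiteDimensional hθ.isIntegral
  have h := minpoly.natDegree_le (A := k) (⟨α, hα⟩ : k⟮θ⟯)
  rw [adjoin.finrank hθ.isIntegral] at h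
  have h2 : IsAlgebraic k (⟨α, hα⟩ : k⟮θ⟯) := Algebra.IsAlgebraic.isAlgebraic _
  refine ⟨h2.algebraMap (A := Ω), ?_⟩
  rwa [← minpoly.algebraMap_eq (algebraMap k⟮θ⟯ Ω).injective] at h

theorem eventually_relClosed {E k₀ : Subfield Ω} (hE : E ≤ k₀) (hr : RelClosed E k₀) {θ : I → Ω}
    {d : ℕ} (hd : ∀ᶠ i in (U : Filter I),
      IsAlgebraic k₀ (θ i) ∧ (minpoly k₀ (θ i)).natDegree ≤ d)
    (H : ∀ α ∈ ultraSub U (fun i ↦ adj k₀ (θ i)), IsAlgebraic (ultraSub U fun _ ↦ E) α →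
      α ∈ ultraSub U fun _ ↦ E) : ∀ᶠ i in (U : Filter I), RelClosed E (adj k₀ (θ i)) := by
  by_contra hc
  rw [← Ultrafilter.eventually_not] at hc
  simp only [RelClosed, not_forall] at hc
  obtain ⟨α, hα⟩ := hc.choice
  have h1 : mk U α ∈ ultraSub U fun _ ↦ E := by
    refine H _ (mk_mem_ultraSub.2 (hα.mono fun i hi ↦ hi.1)) (isAlgebraic_mk (d := d) ?_)
    filter_upwards [hd, hα] with i h2 h3
    obtain ⟨h4, h5, h6⟩ := h3
    refine ⟨h5, ?_⟩
    have h7 := (natDegree_minpoly_le h2.1 h4).2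
    rw [← hr.minpoly_map hE h5, natDegree_map] at h7
    exact h7.trans h2.2
  obtain ⟨i, h2, h3⟩ := ((mk_mem_ultraSub.1 h1).and hα).exists
  obtain ⟨-, -, h4⟩ := h3
  exact h4 h2

end DegreeBounds

section Good

/-- Existential closedness of a field in its regular extensions of transcendence degree one, with
respect to existential statements about polynomial equations and polynomials without roots. -/
def Good (M : Type) [Field M] : Prop :=
  ∀ (m n : ℕ) (G : Finset (MvPolynomial (Fin m ⊕ Fin n) ℤ))
    (f : (MvPolynomial (Fin m ⊕ Fin n) ℤ)[X]) (c : Fin m → M) (N : Type) [Field N] (i : M →+* N)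
    (x : N), IsCurve i x → ∀ z : Fin n → N, Solves Set.univ G f (Sum.elim (i ∘ c) z) →
      ∃ z' : Fin n → M, Solves Set.univ G f (Sum.elim c z')

theorem solves_fieldRange_iff {σ : Type*} {G : Finset (MvPolynomial σ ℤ)}
    {f : (MvPolynomial σ ℤ)[X]} {N : Type*} [Field N] (e : N →+* Ω) {w : σ → N} :
    Solves (e.fieldRange : Set Ω) G f (e ∘ w) ↔ Solves Set.univ G f w := by
  rw [← solves_image_iff e.injective, RingHom.coe_fieldRange, Set.image_univ]

theorem Good.exists_solution {M : Type} [Field M] (hM : Good M) {Ω : Type} [Field Ω] (j : M →+* Ω)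
    {K : Subfield Ω} {x : Ω} (hK : IsCurveIn j.fieldRange K x) {m n : ℕ}
    {G : Finset (MvPolynomial (Fin m ⊕ Fin n) ℤ)} {f : (MvPolynomial (Fin m ⊕ Fin n) ℤ)[X]}
    {c : Fin m → M} {z : Fin n → Ω} (hz : ∀ s, z s ∈ K)
    (h : Solves (K : Set Ω) G f (Sum.elim (j ∘ c) z)) :
    ∃ z' : Fin n → M, Solves Set.univ G f (Sum.elim c z') := by
  let i : M →+* K := j.codRestrict K fun a ↦ hK.le ⟨a, rfl⟩
  have hi : IsCurve i ⟨x, hK.mem⟩ := by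
    rw [isCurve_iff_comp K.subtype, Subfield.fieldRange_subtype]
    exact hK
  refine hM m n G f c K i _ hi (fun s ↦ ⟨z s, hz s⟩) ?_
  rw [← solves_fieldRange_iff K.subtype, Subfield.fieldRange_subtype]
  convert h using 1
  funext s
  rcases s with s | s <;> rfl

theorem Good.ultrapower {M : Type} [Field M] [CharZero M] (hM : Good M) {I : Type}
    (U : Ultrafilter I) : Good (Ultrapower U M) := by
  intro m n G f c N _ i x hN z hz
  let Ω := AlgebraicClosure (RatFunc M)
  let j : M →+* Ω := algebraMap M Ω
  let X : Ω := algebraMap (RatFunc M) Ω RatFunc.X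
  have hX : ¬ IsAlgebraic j.fieldRange X := exists_transcendental_extension M
  have : CharZero Ω := charZero_of_injective_ringHom j.injective
  have hr := fieldRange_ultraMap (U := U) j
  have hXU := not_isAlgebraic_ultraSub U hX
  rw [← hr] at hXU
  obtain ⟨e, he, hex⟩ := exists_embedding hN.not_isAlgebraic (fun y ↦ hN.isAlgebraic y trivial) hXU
  rw [isCurve_iff_comp e, he, hr, hex] at hN
  rw [hr] at hXU
  obtain ⟨h1, h2, h3, h4, h5⟩ := hN
  have hk : adj (ultraSub U fun _ ↦ j.fieldRange) (diag U X) ≤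
      ultraSub U fun _ ↦ adj j.fieldRange X := fun y hy ↦ adjoin_le_ultraSub le_rfl _ hy
  have hkr := relClosed_ultraSub_adjoin U hX
  obtain ⟨θ, hθ, hS, hα⟩ := exists_specialization hk hkr (adj_le h1 h3) h5
    (S := Set.range (e ∘ z)) (Set.finite_range _) (by rintro _ ⟨s, rfl⟩; exact ⟨_, rfl⟩)
  obtain ⟨d, hd⟩ := exists_degree_le hk hθ
  choose zt hzt using fun s ↦ mk_surjective (e (z s))
  choose ct hct using fun s ↦ mk_surjective (c s)
  have ev1 : ∀ᶠ l in (U : Filter I), ∀ s, zt s l ∈ adj (adj j.fieldRange X) (θ l) := by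
    rw [Filter.eventually_all]
    intro s
    rw [← mk_mem_ultraSub (K := fun l ↦ adj (adj j.fieldRange X) (θ l)), hzt]
    exact hS ⟨s, rfl⟩
  have ev2 : ∀ᶠ l in (U : Filter I), RelClosed j.fieldRange (adj (adj j.fieldRange X) (θ l)) := by
    refine eventually_relClosed (le_adj _ _) (relClosed_adj hX) hd fun α h6 h7 ↦ ?_
    exact h2 α (hα α h6 (isAlgebraic_mono (le_adj _ _) h7)) h7
  have ev3 : ∀ᶠ l in (U : Filter I), Solves (adj (adj j.fieldRange X) (θ l) : Set Ω) G f
      (Sum.elim (j ∘ fun s ↦ ct s l) fun s ↦ zt s l) := by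
    rw [← solves_ultraSub_iff (K := fun l ↦ adj (adj j.fieldRange X) (θ l))]
    rw [← solves_fieldRange_iff e] at hz
    have hw : (fun s ↦ mk U fun l ↦ Sum.elim (j ∘ fun s ↦ ct s l) (fun s ↦ zt s l) s) =
        e ∘ Sum.elim (i ∘ c) z := by
      funext s
      rcases s with s | s
      · have := congrArg (· (c s)) he
        simp only [RingHom.comp_apply] at this
        change (mk U fun l ↦ j (ct s l)) = e (i (c s))
        rw [this, ← hct s, ultraMap_mk]
      · exact hzt s
    rw [hw]
    exact hz.of_isAlgebraic (fun s ↦ (⟨_, rfl⟩ : _ ∈ e.fieldRange)) fun α h6 h7 ↦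
      hα α h6 (isAlgebraic_trans (adj_le h1 h3) h5 h7)
  have ev4 : ∀ᶠ l in (U : Filter I), ∃ z' : Fin n → M,
      Solves Set.univ G f (Sum.elim (fun s ↦ ct s l) z') := by
    filter_upwards [ev1, ev2, ev3, hd] with l h6 h7 h8 h9
    refine hM.exists_solution j (x := X) ⟨?_, h7, ?_, hX, fun y hy ↦ ?_⟩ h6 h8
    · exact (le_adj _ _).trans (le_adj _ _)
    · exact le_adj _ _ (mem_adj _ _)
    · exact (natDegree_minpoly_le h9.1 hy).1
  obtain ⟨z', hz'⟩ := ev4.choice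
  refine ⟨fun s ↦ mk U fun l ↦ z' l s, ?_⟩
  have h6 := (solves_ultraSub_iff (U := U) (K := fun _ ↦ (⊤ : Subfield M)) (G := G) (f := f)
    (w := fun l ↦ Sum.elim (fun s ↦ ct s l) (z' l))).2 hz'
  rw [ultraSub_top, Subfield.coe_top] at h6
  have hw : Sum.elim c (fun s ↦ mk U fun l ↦ z' l s) =
      fun s ↦ mk U fun l ↦ Sum.elim (fun s ↦ ct s l) (z' l) s := by
    funext s
    rcases s with s | s
    · exact (hct s).symm
    · rfl
  rw [hw]
  exact h6

end Good

section Embedding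

theorem ev_rename {σ τ R : Type*} [CommRing R] (k : σ → τ) (w : τ → R) (p : MvPolynomial σ ℤ) :
    ev w (MvPolynomial.rename k p) = ev (w ∘ k) p := by
  simp only [ev, MvPolynomial.coe_eval₂Hom, MvPolynomial.eval₂_rename]

theorem eval₂_map_rename {σ τ R : Type*} [CommRing R] (k : σ → τ) (w : τ → R)
    (f : (MvPolynomial σ ℤ)[X]) (y : R) :
    (f.map (MvPolynomial.rename k : MvPolynomial σ ℤ →ₐ[ℤ] _).toRingHom).eval₂ (ev w) y =
      f.eval₂ (ev (w ∘ k)) y := by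
  rw [eval₂_map]
  congr 1
  exact RingHom.ext fun p ↦ ev_rename k w p

theorem exists_fin_embedding {σ : Type*} (s : Finset σ) :
    ∃ (n : ℕ) (k : Fin n → σ), Function.Injective k ∧ Set.range k = s :=
  ⟨s.card, fun a ↦ (s.equivFin.symm a : σ), Subtype.val_injective.comp s.equivFin.symm.injective, by
    ext a
    constructor
    · rintro ⟨b, rfl⟩
      exact (s.equivFin.symm b).2
    · exact fun ha ↦ ⟨s.equivFin ⟨a, ha⟩, by simp⟩⟩

theorem Good.exists_solution' {M : Type} [Field M] (hM : Good M) {N : Type} [Field N] {i : M →+* N}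
    {x : N} (hx : IsCurve i x) {G : Finset (MvPolynomial (M ⊕ N) ℤ)}
    {f : (MvPolynomial (M ⊕ N) ℤ)[X]} (h : Solves Set.univ G f (Sum.elim i id)) :
    ∃ z : N → M, Solves Set.univ G f (Sum.elim id z) := by
  classical
  let s : Finset (M ⊕ N) := G.biUnion MvPolynomial.vars ∪
    (Finset.range (f.natDegree + 1)).biUnion fun j ↦ (f.coeff j).vars
  obtain ⟨m, k₁, hk₁, hr₁⟩ := exists_fin_embedding s.toLeft
  obtain ⟨n, k₂, hk₂, hr₂⟩ := exists_fin_embedding s.toRight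
  let k : Fin m ⊕ Fin n → M ⊕ N := Sum.map k₁ k₂
  have hk : Function.Injective k := hk₁.sumMap hk₂
  have hs : (s : Set (M ⊕ N)) ⊆ Set.range k := by
    rintro (a | a) ha
    · have : a ∈ Set.range k₁ := by rw [hr₁]; simpa using ha
      obtain ⟨b, rfl⟩ := this
      exact ⟨Sum.inl b, rfl⟩
    · have : a ∈ Set.range k₂ := by rw [hr₂]; simpa using ha
      obtain ⟨b, rfl⟩ := this
      exact ⟨Sum.inr b, rfl⟩
  have hlift (p : MvPolynomial (M ⊕ N) ℤ) (hp : p.vars ⊆ s) :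
      ∃ q, MvPolynomial.rename k q = p :=
    MvPolynomial.exists_rename_eq_of_vars_subset_range p k hk
      ((Finset.coe_subset.2 hp).trans hs)
  have hG (g : MvPolynomial (M ⊕ N) ℤ) (hg : g ∈ G) : g.vars ⊆ s :=
    (Finset.subset_biUnion_of_mem MvPolynomial.vars hg).trans Finset.subset_union_left
  have hG' : ∃ G' : Finset (MvPolynomial (Fin m ⊕ Fin n) ℤ),
      G = G'.image (MvPolynomial.rename k) := by
    refine ⟨G.preimage _ (MvPolynomial.rename_injective k hk).injOn, ?_⟩
    rw [Finset.image_preimage, Finset.filter_true_of_mem]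
    exact fun g hg ↦ hlift g (hG g hg)
  obtain ⟨G', rfl⟩ := hG'
  have hf : f ∈ lifts (MvPolynomial.rename k : MvPolynomial _ ℤ →ₐ[ℤ] _).toRingHom := by
    rw [lifts_iff_coeff_lifts]
    intro j
    by_cases hj : j < f.natDegree + 1
    · exact hlift _ ((Finset.subset_biUnion_of_mem (fun j ↦ (f.coeff j).vars)
        (Finset.mem_range.2 hj)).trans Finset.subset_union_right)
    · rw [coeff_eq_zero_of_natDegree_lt (by omega)]
      exact ⟨0, map_zero _⟩
  obtain ⟨f', rfl⟩ := hf
  have key {R : Type} [CommRing R] (w : M ⊕ N → R) :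
      Solves Set.univ (G'.image (MvPolynomial.rename k))
        (f'.map (MvPolynomial.rename k : MvPolynomial _ ℤ →ₐ[ℤ] _).toRingHom) w ↔
      Solves Set.univ G' f' (w ∘ k) := by
    simp only [Solves, Finset.forall_mem_image, ev_rename, eval₂_map_rename]
  rw [coe_mapRingHom, key] at h
  have hw : Sum.elim i id ∘ k = Sum.elim (i ∘ k₁) k₂ := by
    funext a
    rcases a with a | a <;> rfl
  rw [hw] at h
  obtain ⟨z, hz⟩ := hM m n G' f' k₁ N i x hx k₂ h
  refine ⟨Function.extend k₂ z 0, ?_⟩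
  rw [coe_mapRingHom, key]
  have hw' : Sum.elim id (Function.extend k₂ z 0) ∘ k = Sum.elim k₁ z := by
    funext a
    rcases a with a | a
    · rfl
    · exact hk₂.extend_apply _ _ _
  rwa [hw']

/-- A homomorphism which preserves the absence of roots has relatively algebraically closed
image. -/
theorem racHom_of_rootless {N : Type*} [Field N] (e : N →+* Ω)
    (h : ∀ q : N[X], (∀ y, q.eval y ≠ 0) → ∀ α, q.eval₂ e α ≠ 0) : RACHom e := by
  have key (n : ℕ) (q : N[X]) (hn : q.natDegree = n) (hq : q ≠ 0) (α : Ω) (h0 : q.eval₂ e α = 0) :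
      α ∈ e.fieldRange := by
    induction n using Nat.strong_induction_on generalizing q with
    | _ n ih =>
      by_cases hr : ∃ y, q.eval y = 0
      · obtain ⟨y, hy⟩ := hr
        obtain ⟨r, rfl⟩ := dvd_iff_isRoot.2 hy
        rw [eval₂_mul, mul_eq_zero] at h0
        rcases h0 with h0 | h0
        · refine ⟨y, ?_⟩
          rw [eval₂_sub, eval₂_X, eval₂_C, sub_eq_zero] at h0
          exact h0.symm
        · have hr := right_ne_zero_of_mul hq
          rw [natDegree_mul (X_sub_C_ne_zero y) hr, natDegree_X_sub_C] at hn
          exact ih r.natDegree (by omega) r rfl hr h0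
      · push Not at hr
        exact absurd h0 (h q hr α)
  intro α _ hα
  rw [isAlgebraic_iff_subfield] at hα
  obtain ⟨p, hp, hc, h0⟩ := hα
  obtain ⟨q, rfl⟩ : p ∈ lifts e := by
    rw [lifts_iff_coeff_lifts]
    exact hc
  refine key _ q rfl ?_ α ?_
  · rintro rfl
    simp at hp
  · rwa [coe_mapRingHom, eval_map] at h0

/-- If `M` is existentially closed in the sense of `Good`, every regular extension of transcendence
degree one embeds into an ultrapower of `M` over `M`, as a relatively algebraically closed
subfield. -/
theorem Good.exists_racHom {M : Type} [Field M] (hM : Good M) {N : Type} [Field N] {i : M →+* N}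
    {x : N} (hx : IsCurve i x) : ∃ (I : Type) (V : Ultrafilter I) (e : N →+* Ultrapower V M),
      e.comp i = diag V ∧ RACHom e := by
  classical
  let w : M ⊕ N → N := Sum.elim i id
  let Z := {g : MvPolynomial (M ⊕ N) ℤ // ev w g = 0}
  let R := {f : (MvPolynomial (M ⊕ N) ℤ)[X] // ∀ y, f.eval₂ (ev w) y ≠ 0}
  have hsol (l : Finset Z × Finset R) : ∃ z : N → M,
      Solves Set.univ (l.1.image Subtype.val) (∏ f ∈ l.2, f.1) (Sum.elim id z) := by
    refine hM.exists_solution' hx ⟨?_, fun y _ ↦ ?_⟩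
    · rw [Finset.forall_mem_image]
      exact fun g _ ↦ g.2
    · rw [eval₂_finsetProd, Finset.prod_ne_zero_iff]
      exact fun f _ ↦ f.2 y
  choose z hz using hsol
  let V : Ultrafilter (Finset Z × Finset R) := Ultrafilter.of Filter.atTop
  have hV {P : Finset Z × Finset R → Prop} (h : ∀ᶠ l in Filter.atTop, P l) :
      ∀ᶠ l in (V : Filter _), P l := Ultrafilter.of_le _ h
  let w' : M ⊕ N → Ultrapower V M := fun s ↦ mk V fun l ↦ Sum.elim id (z l) s
  have hker (g : MvPolynomial (M ⊕ N) ℤ) (hg : ev w g = 0) : ev w' g = 0 := by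
    rw [ev_mk, mk_eq_zero]
    apply hV
    filter_upwards [Filter.eventually_ge_atTop (({⟨g, hg⟩}, ∅) : Finset Z × Finset R)] with l hl
    exact (hz l).1 g (Finset.mem_image.2 ⟨⟨g, hg⟩, hl.1 (by simp), rfl⟩)
  have hroot (f : (MvPolynomial (M ⊕ N) ℤ)[X]) (hf : ∀ y, f.eval₂ (ev w) y ≠ 0)
      (α : Ultrapower V M) : f.eval₂ (ev w') α ≠ 0 := by
    obtain ⟨α, rfl⟩ := mk_surjective α
    rw [eval₂_ev_mk, Ne, mk_eq_zero, ← Ultrafilter.eventually_not]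
    apply hV
    filter_upwards [Filter.eventually_ge_atTop ((∅, {⟨f, hf⟩}) : Finset Z × Finset R)] with l hl
    have h := (hz l).2 (α l) trivial
    rw [eval₂_finsetProd, Finset.prod_ne_zero_iff] at h
    exact h ⟨f, hf⟩ (hl.2 (by simp))
  have hX {S : Type} [CommRing S] (v : M ⊕ N → S) (s) : ev v (MvPolynomial.X s) = v s := by
    simp [ev]
  have hsurj : Function.Surjective (ev w) := fun a ↦ ⟨MvPolynomial.X (Sum.inr a), hX _ _⟩
  let e : N →+* Ultrapower V M := (ev w).liftOfSurjective hsurj ⟨ev w', fun g hg ↦ hker g hg⟩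
  have he : e.comp (ev w) = ev w' := RingHom.liftOfRightInverse_comp _ _ _ _
  refine ⟨_, V, e, RingHom.ext fun a ↦ ?_, racHom_of_rootless e fun q hq α ↦ ?_⟩
  · have h := congrArg (· (MvPolynomial.X (Sum.inl a))) he
    simp only [RingHom.comp_apply, hX] at h
    exact h
  · obtain ⟨f, rfl, -⟩ := exists_poly_lift hsurj q
    rw [eval₂_map, he]
    refine hroot f (fun y ↦ ?_) α
    rw [← eval_map]
    exact hq y

end Embedding

section Topology

/-- The basic clopen set of subfields containing `W` and omitting `B`. -/
def basicOpen (W B : Set Qbar) : Set (Subfield Qbar) :=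
  {F | W ⊆ F ∧ ∀ b ∈ B, b ∉ F}

theorem isOpen_basicOpen {W B : Set Qbar} (hW : W.Finite) (hB : B.Finite) :
    IsOpen (basicOpen W B) := by
  let _ := propDiscrete
  let _ := powersetTopology
  have : DiscreteTopology Prop := ⟨rfl⟩
  refine isOpen_induced_iff.2 ⟨{s | W ⊆ s ∧ ∀ b ∈ B, b ∉ s}, ?_, rfl⟩
  have hc (a : Qbar) : Continuous fun s : Set Qbar ↦ a ∈ s :=
    continuous_apply (A := fun _ : Qbar ↦ Prop) a
  have h1 (a : Qbar) : IsOpen {s : Set Qbar | a ∈ s} :=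
    (hc a).isOpen_preimage {p | p} (isOpen_discrete _)
  have h2 (a : Qbar) : IsOpen {s : Set Qbar | a ∉ s} :=
    (hc a).isOpen_preimage {p | ¬ p} (isOpen_discrete _)
  have : {s : Set Qbar | W ⊆ s ∧ ∀ b ∈ B, b ∉ s} =
      (⋂ a ∈ W, {s | a ∈ s}) ∩ ⋂ b ∈ B, {s | b ∉ s} := by
    ext s
    simp [Set.subset_def]
  rw [this]
  exact (hW.isOpen_biInter fun a _ ↦ h1 a).inter (hB.isOpen_biInter fun a _ ↦ h2 a)

theorem exists_basicOpen_subset {O : Set (Subfield Qbar)} (hO : IsOpen O) {F : Subfield Qbar}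
    (hF : F ∈ O) : ∃ W B : Set Qbar, W.Finite ∧ B.Finite ∧ F ∈ basicOpen W B ∧
      basicOpen W B ⊆ O := by
  let _ := powersetTopology
  obtain ⟨T, hT, rfl⟩ := isOpen_induced_iff.1 hO
  obtain ⟨I, u, hu, hI⟩ := (@isOpen_pi_iff Qbar (fun _ ↦ Prop) (fun _ ↦ propDiscrete) T).1 hT _ hF
  refine ⟨{a | a ∈ I ∧ a ∈ F}, {a | a ∈ I ∧ a ∉ F}, I.finite_toSet.subset fun a h ↦ h.1,
    I.finite_toSet.subset fun a h ↦ h.1, ⟨fun a h ↦ h.2, fun a h ↦ h.2⟩, ?_⟩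
  rintro F' ⟨h1, h2⟩
  refine hI fun a ha ↦ ?_
  have : (F' : Set Qbar) a = (F : Set Qbar) a := by
    refine propext ⟨fun h ↦ ?_, fun h ↦ h1 ⟨ha, h⟩⟩
    by_contra hc
    exact h2 a ⟨ha, hc⟩ h
  change (F' : Set Qbar) a ∈ u a
  rw [this]
  exact (hu a ha).2

theorem isNowhereDense_of_basicOpen {S : Set (Subfield Qbar)}
    (h : ∀ W B : Set Qbar, W.Finite → B.Finite → ∀ F ∈ S, F ∈ basicOpen W B →
      ∃ W' B' : Set Qbar, W'.Finite ∧ B'.Finite ∧ (basicOpen (W ∪ W') (B ∪ B')).Nonempty ∧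
        Disjoint (basicOpen W' B') S) : IsNowhereDense S := by
  rw [IsNowhereDense, Set.eq_empty_iff_forall_notMem]
  intro F₀ hF₀
  obtain ⟨F, hF, hFS⟩ := mem_closure_iff.1 (interior_subset hF₀) _ isOpen_interior hF₀
  obtain ⟨W, B, hW, hB, hFWB, hWB⟩ := exists_basicOpen_subset isOpen_interior hF
  obtain ⟨W', B', hW', hB', ⟨F', h1, h2⟩, hd⟩ := h W B hW hB F hFS hFWB
  have h3 : F' ∈ basicOpen W B := ⟨Set.subset_union_left.trans h1, fun b hb ↦ h2 b (Or.inl hb)⟩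
  have h4 : F' ∈ basicOpen W' B' := ⟨Set.subset_union_right.trans h1, fun b hb ↦ h2 b (Or.inr hb)⟩
  obtain ⟨F'', h5, h6⟩ :=
    mem_closure_iff.1 (interior_subset (hWB h3)) _ (isOpen_basicOpen hW' hB') h4
  exact Set.disjoint_left.1 hd h5 h6

instance countable_polynomial {R : Type} [CommRing R] [Countable R] : Countable R[X] := by
  rw [← Cardinal.mk_le_aleph0_iff]
  exact Polynomial.cardinalMk_le_max.trans (by simp)

instance countable_mvPolynomial {R σ : Type} [CommRing R] [Countable R] [Countable σ] :
    Countable (MvPolynomial σ R) := by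
  rw [← Cardinal.mk_le_aleph0_iff]
  exact MvPolynomial.cardinalMk_le_max.trans (by simp)

instance isAlgebraic_qbar : Algebra.IsAlgebraic ℚ Qbar := by
  rw [Subsingleton.elim (DivisionRing.toRatAlgebra : Algebra ℚ Qbar)
    (AlgebraicClosure.instAlgebra ℚ)]
  exact AlgebraicClosure.isAlgebraic ℚ

instance countable_qbar : Countable Qbar := by
  rw [← Cardinal.mk_le_aleph0_iff]
  exact (Algebra.IsAlgebraic.cardinalMk_le_max ℚ Qbar).trans (by simp)

end Topology

section Generic

theorem isAlgebraic_diag_qbar {I : Type*} {U : Ultrafilter I} (k : Subfield (Ultrapower U Qbar))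
    (q : Qbar) : IsAlgebraic k (diag U q) :=
  (Algebra.IsAlgebraic.isAlgebraic (R := ℚ) q).ringHom_of_comp_eq (algebraMap ℚ k) (diag U)
    (algebraMap ℚ k).injective (RingHom.ext_rat _ _)

/-- The relative algebraic closure of a subfield. -/
def racl (k : Subfield Ω) : Subfield Ω := (algebraicClosure k Ω).toSubfield

theorem mem_racl {k : Subfield Ω} {x : Ω} : x ∈ racl k ↔ IsAlgebraic k x :=
  mem_algebraicClosure_iff

/-- A regular extension of transcendence degree one of a field of algebraic numbers specializes,
preserving finitely many solutions and elements that are not in the field. -/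
theorem exists_subfield_of_isCurve {F : Subfield Qbar} {N : Type*} [Field N] {i : F →+* N} {x : N}
    (hx : IsCurve i x) {m n : ℕ} {G : Finset (MvPolynomial (Fin m ⊕ Fin n) ℤ)}
    {f : (MvPolynomial (Fin m ⊕ Fin n) ℤ)[X]} {c : Fin m → F} {z : Fin n → N}
    (hz : Solves Set.univ G f (Sum.elim (i ∘ c) z)) {W B : Set Qbar} (hW : W.Finite)
    (hB : B.Finite) (hF : F ∈ basicOpen W B) :
    ∃ F' ∈ basicOpen W B, (∀ s, (c s : Qbar) ∈ F') ∧ ∃ z' : Fin n → Qbar, (∀ s, z' s ∈ F') ∧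
      Solves (F' : Set Qbar) G f (Sum.elim (fun s ↦ c s) z') := by
  obtain ⟨U, hU⟩ := exists_ultrafilter_hilbertSet
  let t := mk U fun n : ℤ ↦ (n : Qbar)
  let j : F →+* Ultrapower U Qbar := (diag U).comp F.subtype
  have hj : j.fieldRange ≤ (diag U (M := Qbar)).fieldRange := by
    rintro _ ⟨a, rfl⟩
    exact ⟨a, rfl⟩
  have ht : ¬ IsAlgebraic j.fieldRange t := fun h ↦
    not_isAlgebraic_mk_intCast hU (isAlgebraic_mono hj h)
  obtain ⟨e, he, hex⟩ := exists_embedding hx.not_isAlgebraic (fun y ↦ hx.isAlgebraic y trivial) ht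
  rw [isCurve_iff_comp e, he, hex] at hx
  have hei (a : F) : e (i a) = diag U (a : Qbar) := congrArg (· a) he
  have hk : Subfield.closure {t} ≤ ultraSub U fun _ ↦ (⊥ : Subfield Qbar) := by
    rw [Subfield.closure_le, Set.singleton_subset_iff]
    exact mk_mem_ultraSub.2 (Filter.Eventually.of_forall fun l ↦ intCast_mem _ l)
  have hkL : Subfield.closure {t} ≤ e.fieldRange := by
    rw [Subfield.closure_le, Set.singleton_subset_iff]
    exact hx.mem
  have halg (y) (hy : y ∈ e.fieldRange) : IsAlgebraic (Subfield.closure {t}) y := by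
    have h1 : adj j.fieldRange t ≤ racl (Subfield.closure {t}) := by
      refine adj_le ?_ (mem_racl.2 ?_)
      · rintro _ ⟨a, rfl⟩
        exact mem_racl.2 (isAlgebraic_diag_qbar _ (a : Qbar))
      · exact isAlgebraic_algebraMap
          (⟨t, Subfield.subset_closure rfl⟩ : Subfield.closure {t})
    have h2 := isAlgebraic_mono h1 (hx.isAlgebraic y hy)
    exact isAlgebraic_trans (fun a ha ↦ mem_racl.2 (isAlgebraic_algebraMap
      (⟨a, ha⟩ : Subfield.closure {t}))) (fun y hy ↦ mem_racl.1 hy) h2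
  have hS : (diag U '' W ∪ Set.range (fun s ↦ diag U (c s : Qbar)) ∪ Set.range (e ∘ z)).Finite :=
    ((hW.image _).union (Set.finite_range _)).union (Set.finite_range _)
  obtain ⟨θ, hθ, hSθ, hα⟩ := exists_specialization hk (relClosed_closure_intCast hU) hkL halg hS
    (by
      rintro _ ((⟨w, hw, rfl⟩ | ⟨s, rfl⟩) | ⟨s, rfl⟩)
      · exact ⟨i ⟨w, hF.1 hw⟩, hei _⟩
      · exact ⟨i (c s), hei _⟩
      · exact ⟨_, rfl⟩)
  choose zt hzt using fun s ↦ mk_surjective (e (z s))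
  have ev1 : ∀ᶠ l in (U : Filter ℤ), ∀ s, zt s l ∈ adj ⊥ (θ l) := by
    rw [Filter.eventually_all]
    intro s
    rw [← mk_mem_ultraSub (K := fun l ↦ adj ⊥ (θ l)), hzt]
    exact hSθ (Or.inr ⟨s, rfl⟩)
  have ev2 : ∀ᶠ l in (U : Filter ℤ), ∀ s, (c s : Qbar) ∈ adj ⊥ (θ l) := by
    rw [Filter.eventually_all]
    intro s
    rw [← mk_mem_ultraSub (K := fun l ↦ adj ⊥ (θ l))]
    exact hSθ (Or.inl (Or.inr ⟨s, rfl⟩))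
  have ev3 : ∀ᶠ l in (U : Filter ℤ), ∀ w ∈ W, w ∈ adj ⊥ (θ l) := by
    rw [Filter.eventually_all_finite hW]
    intro w hw
    rw [← mk_mem_ultraSub (K := fun l ↦ adj ⊥ (θ l)) (f := fun _ ↦ w)]
    exact hSθ (Or.inl (Or.inl ⟨w, hw, rfl⟩))
  have ev4 : ∀ᶠ l in (U : Filter ℤ), ∀ b ∈ B, b ∉ adj ⊥ (θ l) := by
    rw [Filter.eventually_all_finite hB]
    intro b hb
    rw [Ultrafilter.eventually_not, ← mk_mem_ultraSub (K := fun l ↦ adj ⊥ (θ l)) (f := fun _ ↦ b)]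
    intro hb'
    obtain ⟨a, ha⟩ := hx.relClosed _ (hα _ hb' (isAlgebraic_diag_qbar _ b))
      (isAlgebraic_diag_qbar _ b)
    refine hF.2 b hb ?_
    rw [← (diag U (M := Qbar)).injective (ha : diag U (a : Qbar) = diag U b)]
    exact a.2
  have ev5 : ∀ᶠ l in (U : Filter ℤ), Solves (adj ⊥ (θ l) : Set Qbar) G f
      (Sum.elim (fun s ↦ c s) fun s ↦ zt s l) := by
    rw [← solves_ultraSub_iff (K := fun l ↦ adj ⊥ (θ l))]
    rw [← solves_fieldRange_iff e] at hz
    have hw : (fun s ↦ mk U fun l ↦ Sum.elim (fun s ↦ (c s : Qbar)) (fun s ↦ zt s l) s) =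
        e ∘ Sum.elim (i ∘ c) z := by
      funext s
      rcases s with s | s
      · exact (hei (c s)).symm
      · exact hzt s
    rw [hw]
    exact hz.of_isAlgebraic (fun s ↦ (⟨_, rfl⟩ : _ ∈ e.fieldRange)) fun α h6 h7 ↦
      hα α h6 (isAlgebraic_trans hkL halg h7)
  obtain ⟨l, h1, h2, h3, h4, h5⟩ := (ev1.and (ev2.and (ev3.and (ev4.and ev5)))).exists
  exact ⟨_, ⟨h3, h4⟩, h2, fun s ↦ zt s l, h1, h5⟩

theorem isMeagre_not_good : IsMeagre {F : Subfield Qbar | ¬ Good F} := by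
  let Bad (m n : ℕ) (G : Finset (MvPolynomial (Fin m ⊕ Fin n) ℤ))
      (f : (MvPolynomial (Fin m ⊕ Fin n) ℤ)[X]) (c : Fin m → Qbar) : Set (Subfield Qbar) :=
    {F | ∃ c' : Fin m → F, (∀ s, (c' s : Qbar) = c s) ∧
      (∃ (N : Type) (_ : Field N) (i : F →+* N) (x : N), IsCurve i x ∧
        ∃ z : Fin n → N, Solves Set.univ G f (Sum.elim (i ∘ c') z)) ∧
      ¬ ∃ z' : Fin n → F, Solves Set.univ G f (Sum.elim c' z')}
  have hsub : {F : Subfield Qbar | ¬ Good F} ⊆ ⋃ m, ⋃ n, ⋃ G, ⋃ f, ⋃ c, Bad m n G f c := by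
    intro F hF
    simp only [Set.mem_ofPred_eq, Good, not_forall] at hF
    obtain ⟨m, n, G, f, c, N, hN, i, x, hx, z, hz, hc⟩ := hF
    simp only [Set.mem_iUnion]
    exact ⟨m, n, G, f, fun s ↦ c s, c, fun _ ↦ rfl, ⟨N, hN, i, x, hx, z, hz⟩, hc⟩
  refine IsMeagre.mono hsub ?_
  refine isMeagre_iUnion fun m ↦ isMeagre_iUnion fun n ↦ isMeagre_iUnion fun G ↦
    isMeagre_iUnion fun f ↦ isMeagre_iUnion fun c ↦ IsNowhereDense.isMeagre ?_
  apply isNowhereDense_of_basicOpen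
  rintro W B hW hB F ⟨c', hc, ⟨N, _, i, x, hx, z, hz⟩, -⟩ hF
  obtain ⟨F', hF', hcF, z', hz', hsol⟩ := exists_subfield_of_isCurve hx hz hW hB hF
  simp only [hc] at hcF hsol
  let q : Polynomial Qbar := f.map (ev (Sum.elim c z'))
  have hq : q ≠ 0 := by
    intro h0
    refine hsol.2 0 (zero_mem F') ?_
    rw [← eval_map]
    change q.eval 0 = 0
    rw [h0, eval_zero]
  refine ⟨Set.range c ∪ Set.range z', {y | q.IsRoot y},
    (Set.finite_range _).union (Set.finite_range _), finite_setOfPred_isRoot hq, ⟨F', ?_, ?_⟩, ?_⟩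
  · rintro y (hy | ⟨s, rfl⟩ | ⟨s, rfl⟩)
    exacts [hF'.1 hy, hcF s, hz' s]
  · rintro y (hy | hy) hy'
    · exact hF'.2 y hy hy'
    · refine hsol.2 y hy' ?_
      rw [← eval_map]
      exact hy
  · rw [Set.disjoint_left]
    rintro F'' ⟨h1, h2⟩ ⟨c'', hc'', -, hno⟩
    refine hno ⟨fun s ↦ ⟨z' s, h1 (Or.inr ⟨s, rfl⟩)⟩, ?_⟩
    rw [← solves_fieldRange_iff F''.subtype, Subfield.fieldRange_subtype]
    have hw : F''.subtype ∘ Sum.elim c'' (fun s ↦ ⟨z' s, h1 (Or.inr ⟨s, rfl⟩)⟩) =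
        Sum.elim c z' := by
      funext s
      rcases s with s | s
      · exact hc'' s
      · rfl
    rw [hw]
    refine ⟨hsol.1, fun y hy h0 ↦ h2 y ?_ hy⟩
    rw [← eval_map] at h0
    exact h0

end Generic

section Amalgam

theorem adjoin_toSubfield_le {k K : Subfield Ω} {S : Set Ω} (h : k ≤ K) (hS : S ⊆ K) :
    (adjoin k S).toSubfield ≤ K := by
  change Subfield.closure _ ≤ _
  rw [Subfield.closure_le]
  rintro y (⟨a, rfl⟩ | hy)
  exacts [h a.2, hS hy]

theorem le_racl (k : Subfield Ω) : k ≤ racl k := fun a ha ↦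
  mem_racl.2 (isAlgebraic_algebraMap (⟨a, ha⟩ : k))

theorem relClosed_racl (k K : Subfield Ω) : RelClosed (racl k) K := fun _ _ hx ↦
  mem_racl.2 (isAlgebraic_trans (le_racl k) (fun _ hy ↦ mem_racl.1 hy) hx)

theorem natDegree_minpoly_anti {k K : Subfield Ω} (h : k ≤ K) {x : Ω} (hx : IsAlgebraic k x) :
    (minpoly K x).natDegree ≤ (minpoly k x).natDegree := by
  let _ : Algebra k K := (Subfield.inclusion h).toAlgebra
  have : IsScalarTower k K Ω := IsScalarTower.of_algebraMap_eq fun _ ↦ rfl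
  have hm := (minpoly.monic hx.isIntegral).map (algebraMap k K)
  have hd := natDegree_le_of_dvd (minpoly.dvd_map_of_isScalarTower k K x) hm.ne_zero
  rwa [(minpoly.monic hx.isIntegral).natDegree_map] at hd

/-- Symmetry of linear disjointness for simple algebraic extensions. -/
theorem natDegree_minpoly_comm {k : Subfield Ω} {β θ : Ω} (hβ : IsAlgebraic k β)
    (hθ : IsAlgebraic k θ)
    (h : (minpoly k β).natDegree ≤ (minpoly (adj k θ) β).natDegree) :
    (minpoly k θ).natDegree ≤ (minpoly (adj k β) θ).natDegree := by
  have key (α γ : Ω) (hα : IsAlgebraic k α) (hγ : IsAlgebraic k γ) :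
      (minpoly k α).natDegree * (minpoly (adj k α) γ).natDegree =
        Module.finrank k (k⟮α⟯⟮γ⟯.restrictScalars k) := by
    have h1 : IsIntegral k⟮α⟯ γ := (isAlgebraic_mono (le_adj k α) hγ).isIntegral
    rw [← adjoin.finrank hα.isIntegral]
    refine (congrArg _ (adjoin.finrank h1).symm).trans ?_
    exact Module.finrank_mul_finrank k k⟮α⟯ k⟮α⟯⟮γ⟯
  have h1 := key β θ hβ hθ
  rw [adjoin_simple_comm, ← key θ β hθ hβ] at h1
  have h2 : 0 < (minpoly k β).natDegree := minpoly.natDegree_pos hβ.isIntegral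
  by_contra! hc
  have h3 := Nat.mul_lt_mul_of_lt_of_le' hc h h2
  rw [← h1, mul_comm] at h3
  exact lt_irrefl _ h3

theorem exists_simple_adjoin [CharZero Ω] {k K : Subfield Ω} (h : k ≤ K) {S : Set Ω}
    (hS : ∀ s ∈ S, IsAlgebraic k s) {T : Set Ω} (hT : T.Finite)
    (hTS : T ⊆ (adjoin K S : Set Ω)) :
    ∃ θ ∈ adjoin k S, IsAlgebraic k θ ∧ T ⊆ (K⟮θ⟯ : Set Ω) := by
  classical
  have h1 (t : T) : ∃ S' : Finset Ω, (S' : Set Ω) ⊆ S ∧ (t : Ω) ∈ adjoin K (S' : Set Ω) :=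
    exists_finset_of_mem_adjoin (hTS t.2)
  choose S' hS' hmem using h1
  have := hT.to_subtype
  have hfin : (⋃ t, (S' t : Set Ω)).Finite := Set.finite_iUnion fun t ↦ (S' t).finite_toSet
  have hsub : (⋃ t, (S' t : Set Ω)) ⊆ S := Set.iUnion_subset hS'
  obtain ⟨θ, hθ, hadj⟩ := exists_primitive (k := k) hfin fun x hx ↦ hS x (hsub hx)
  refine ⟨θ, ?_, hθ, fun t ht ↦ ?_⟩
  · exact adjoin.mono _ _ _ hsub (hadj ▸ mem_adjoin_simple_self k θ)
  · refine adjoin_le_adjoin (le_refl K) (fun y hy ↦ ?_) (hmem ⟨t, ht⟩)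
    refine adjoin_mono' h ?_
    rw [← hadj]
    exact subset_adjoin _ _ (Set.mem_iUnion.2 ⟨⟨t, ht⟩, hy⟩)

/-- In a regular extension of transcendence degree one, algebraic extension of the constants does
not lower degrees over the rational function field. -/
theorem IsCurveIn.natDegree_minpoly_le [CharZero Ω] {E A : Subfield Ω} {x : Ω}
    (hA : IsCurveIn E A x) {θ : Ω} (hθ : θ ∈ A) :
    (minpoly (adj E x) θ).natDegree ≤ (minpoly (adj (racl E) x) θ).natDegree := by
  have halg := hA.isAlgebraic θ hθ
  have hle : adj E x ≤ adj (racl E) x := adj_le ((le_racl E).trans (le_adj _ _)) (mem_adj _ _)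
  have halg' := isAlgebraic_mono hle halg
  let p := minpoly (adj (racl E) x) θ
  have hsub : adj (racl E) x ≤ (adjoin (adj E x) (racl E : Set Ω)).toSubfield :=
    adj_le (fun y hy ↦ subset_adjoin (adj E x) (racl E : Set Ω) hy)
      ((adjoin (adj E x) (racl E : Set Ω)).algebraMap_mem ⟨x, mem_adj E x⟩)
  let T : Set Ω := (fun n ↦ (p.coeff n : Ω)) '' Finset.range (p.natDegree + 1)
  obtain ⟨β, hβE, hβ, hT⟩ := exists_simple_adjoin (le_adj E x) (S := (racl E : Set Ω))
    (fun s hs ↦ mem_racl.1 hs) (T := T) ((Finset.finite_toSet _).image _) (by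
      rintro _ ⟨n, -, rfl⟩
      exact hsub (p.coeff n).2)
  have hc (n : ℕ) : (p.coeff n : Ω) ∈ adj (adj E x) β := by
    by_cases hn : n < p.natDegree + 1
    · exact hT ⟨n, by simpa using hn, rfl⟩
    · rw [coeff_eq_zero_of_natDegree_lt (by omega)]
      exact zero_mem _
  have hp : ∃ q : Polynomial (adj (adj E x) β),
      q.map (Subfield.subtype _) = p.map (Subfield.subtype _) := by
    have : p.map (Subfield.subtype _) ∈ lifts (adj (adj E x) β).subtype := by
      rw [lifts_iff_coeff_lifts]
      intro n
      rw [coeff_map]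
      exact ⟨⟨_, hc n⟩, rfl⟩
    exact this
  obtain ⟨q, hq⟩ := hp
  have hd : q.natDegree = p.natDegree := by
    have := congrArg natDegree hq
    rwa [natDegree_map, natDegree_map] at this
  have hq0 : q ≠ 0 := by
    rintro rfl
    rw [Polynomial.map_zero, eq_comm, Polynomial.map_eq_zero] at hq
    exact minpoly.ne_zero halg'.isIntegral hq
  have hqθ : aeval θ q = 0 := by
    have h1 : (q.map (Subfield.subtype _)).eval θ = (p.map (Subfield.subtype _)).eval θ := by
      rw [hq]
    rw [eval_map, eval_map] at h1
    exact h1.trans (minpoly.aeval _ θ)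
  have hβx : IsAlgebraic (adj E x) β := isAlgebraic_mono (le_adj E x) hβ
  calc _ ≤ (minpoly (adj (adj E x) β) θ).natDegree := by
        refine natDegree_minpoly_comm hβx halg ?_
        calc _ ≤ (minpoly E β).natDegree := natDegree_minpoly_anti (le_adj E x) hβ
          _ = (minpoly A β).natDegree := by
            rw [← hA.relClosed.minpoly_map hA.le hβ, natDegree_map]
          _ ≤ _ := natDegree_minpoly_anti (adj_le (adj_le hA.le hA.mem) hθ)
            (isAlgebraic_mono (le_adj _ _) hβx)
    _ ≤ q.natDegree := natDegree_le_of_dvd (minpoly.dvd _ _ hqθ) hq0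
    _ = _ := hd

theorem mem_of_mem_adjoin {K L : Subfield Ω} (h : K ≤ L) {θ α : Ω} (hθ : IsAlgebraic K θ)
    (hα : α ∈ K⟮θ⟯) (hαL : α ∈ L)
    (hd : (minpoly K θ).natDegree ≤ (minpoly L θ).natDegree) : α ∈ K := by
  obtain ⟨p, hp, hpα⟩ := exists_poly_of_mem_adjoin hθ hα
  let q : Polynomial L := p.map (Subfield.inclusion h) - C ⟨α, hαL⟩
  have hq : aeval θ q = 0 := by
    rw [map_sub, aeval_C, sub_eq_zero, aeval_def, eval₂_map]
    exact hpα
  have hdq : q.natDegree < (minpoly L θ).natDegree := by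
    rw [natDegree_sub_C]
    exact natDegree_map_le.trans_lt (hp.trans_le hd)
  have hq0 := eq_zero_of_dvd_of_natDegree_lt (minpoly.dvd _ _ hq) hdq
  have h0 := congrArg (coeff · 0) hq0
  simp only [q, coeff_sub, coeff_map, coeff_C_zero, coeff_zero, sub_eq_zero] at h0
  have h1 : (p.coeff 0 : Ω) = α := congrArg Subtype.val h0
  rw [← h1]
  exact (p.coeff 0).2

/-- The compositum of two regular extensions that are algebraically free, one of them of
transcendence degree one. -/
theorem exists_compositum [CharZero Ω] {E A B : Subfield Ω} {x : Ω} (hA : IsCurveIn E A x)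
    (hEB : E ≤ B) (hB : RelClosed E B) (hx : ¬ IsAlgebraic B x) :
    ∃ N : Subfield Ω, A ≤ N ∧ RelClosed A N ∧ IsCurveIn B N x := by
  have hk : adj E x ≤ adj B x := adj_le (hEB.trans (le_adj _ _)) (mem_adj _ _)
  have hkr : RelClosed (adj E x) (adj B x) := RelClosed.adjoin_transcendental hEB hB hx
  have hsimple (α) (hα : α ∈ adjoin (adj B x) (A : Set Ω)) :
      ∃ θ ∈ A, α ∈ (adj B x)⟮θ⟯ := by
    obtain ⟨θ, h1, -, h2⟩ := exists_simple_adjoin hk (fun s hs ↦ hA.isAlgebraic s hs)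
      (Set.finite_singleton α) (Set.singleton_subset_iff.2 hα)
    exact ⟨θ, adjoin_toSubfield_le (adj_le hA.le hA.mem) le_rfl h1, h2 rfl⟩
  have hKN : adj B x ≤ (adjoin (adj B x) (A : Set Ω)).toSubfield := fun y hy ↦
    (adjoin (adj B x) (A : Set Ω)).algebraMap_mem ⟨y, hy⟩
  refine ⟨(adjoin (adj B x) (A : Set Ω)).toSubfield, fun a ha ↦ subset_adjoin _ _ ha, ?_,
    (le_adj _ _).trans hKN, ?_, hKN (mem_adj _ _), hx, fun y hy ↦ ?_⟩
  · intro α hα ha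
    obtain ⟨θ, hθ, hmem⟩ := hsimple α hα
    have h1 := isAlgebraic_trans (adj_le hA.le hA.mem) hA.isAlgebraic ha
    have h2 := hkr.mem_adjoin hk (hA.isAlgebraic θ hθ) h1 hmem
    exact adj_le (adj_le hA.le hA.mem) hθ h2
  · intro α hα ha
    refine relClosed_adj hx α ?_ ha
    obtain ⟨θ, hθ, hmem⟩ := hsimple α hα
    have hθk := hA.isAlgebraic θ hθ
    have hθK := isAlgebraic_mono hk hθk
    have hle : adj B x ≤ adj (racl B) x := adj_le ((le_racl B).trans (le_adj _ _)) (mem_adj _ _)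
    have hEB' : racl E ≤ racl B := fun y hy ↦ mem_racl.2 (isAlgebraic_mono hEB (mem_racl.1 hy))
    have hx' : ¬ IsAlgebraic (racl B) x := fun h ↦
      hx (isAlgebraic_trans (le_racl B) (fun y hy ↦ mem_racl.1 hy) h)
    have hle' : adj (racl E) x ≤ adj (racl B) x := adj_le (hEB'.trans (le_adj _ _)) (mem_adj _ _)
    have hleE : adj E x ≤ adj (racl E) x := adj_le ((le_racl E).trans (le_adj _ _)) (mem_adj _ _)
    have hr' : RelClosed (adj (racl E) x) (adj (racl B) x) :=
      RelClosed.adjoin_transcendental hEB' (relClosed_racl E _) hx'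
    have hαB : α ∈ adj (racl B) x := le_adj _ _ (mem_racl.2 ha)
    refine mem_of_mem_adjoin hle hθK hmem hαB ?_
    rw [← hr'.minpoly_map hle' (isAlgebraic_mono hleE hθk), natDegree_map]
    exact (natDegree_minpoly_anti hk hθk).trans (hA.natDegree_minpoly_le hθ)
  · have h1 : (adjoin (adj B x) (A : Set Ω)).toSubfield ≤ racl (adj B x) :=
      adjoin_toSubfield_le (le_racl _) fun a ha ↦
        mem_racl.2 (isAlgebraic_mono hk (hA.isAlgebraic a ha))
    exact mem_racl.1 (h1 hy)

theorem exists_amalgam {E A B : Type} [Field E] [Field A] [Field B] [CharZero B] {i : E →+* A}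
    {a : A} (hi : IsCurve i a) {j : E →+* B} (hj : RACHom j) :
    ∃ (N : Type) (_ : Field N) (iA : A →+* N) (iB : B →+* N), iA.comp i = iB.comp j ∧
      RACHom iA ∧ IsCurve iB (iA a) := by
  let Ω := AlgebraicClosure (RatFunc B)
  let jB : B →+* Ω := algebraMap B Ω
  let X : Ω := algebraMap (RatFunc B) Ω RatFunc.X
  have hX : ¬ IsAlgebraic jB.fieldRange X := exists_transcendental_extension B
  have : CharZero Ω := charZero_of_injective_ringHom jB.injective
  have hle : (jB.comp j).fieldRange ≤ jB.fieldRange := by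
    rintro _ ⟨y, rfl⟩
    exact ⟨j y, rfl⟩
  obtain ⟨jA, hjA, hjX⟩ := exists_embedding hi.not_isAlgebraic
    (fun y ↦ hi.isAlgebraic y trivial) (j := jB.comp j) fun h ↦ hX (isAlgebraic_mono hle h)
  rw [isCurve_iff_comp jA, hjA, hjX] at hi
  rw [racHom_iff_comp jB] at hj
  obtain ⟨N, hAN, hrA, hB⟩ := exists_compositum hi hle hj hX
  let iA : A →+* N := jA.codRestrict N fun y ↦ hAN ⟨y, rfl⟩
  let iB : B →+* N := jB.codRestrict N fun y ↦ hB.le ⟨y, rfl⟩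
  refine ⟨N, inferInstance, iA, iB, RingHom.ext fun y ↦ Subtype.ext ?_, ?_, ?_⟩
  · exact congrArg (· y) hjA
  · rw [racHom_iff_comp N.subtype, Subfield.fieldRange_subtype]
    exact hrA
  · rw [isCurve_iff_comp N.subtype, Subfield.fieldRange_subtype]
    have : N.subtype (iA a) = X := hjX
    rw [this]
    exact hB

end Amalgam

section Formulas

variable {α : Type*}

/-- The value of a term in the language of rings. -/
def termEval {R : Type*} [CommRing R] (v : α → R) (t : Language.ring.Term α) : R :=
  letI := FirstOrder.Ring.compatibleRingOfRing R
  t.realize v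

theorem apply_termEval {R S : Type*} [CommRing R] [CommRing S] (g : R →+* S) (v : α → R)
    (t : Language.ring.Term α) : g (termEval v t) = termEval (g ∘ v) t := by
  induction t with
  | var _ => rfl
  | func f ts ih =>
    cases f with
    | add =>
      exact (map_add g (termEval v (ts 0)) (termEval v (ts 1))).trans
        (congrArg₂ _ (ih 0) (ih 1))
    | mul =>
      exact (map_mul g (termEval v (ts 0)) (termEval v (ts 1))).trans
        (congrArg₂ _ (ih 0) (ih 1))
    | neg => exact (map_neg g (termEval v (ts 0))).trans (congrArg _ (ih 0))
    | zero => exact map_zero g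
    | one => exact map_one g

/-- Satisfaction of a formula of the language of rings in a field. -/
def Holds (M : Type*) [Field M] {n : ℕ} (φ : Language.ring.BoundedFormula α n)
    (v : α → M) (xs : Fin n → M) : Prop :=
  letI := FirstOrder.Ring.compatibleRingOfRing M
  φ.Realize v xs

section Clauses

variable {M : Type*} [Field M] {n : ℕ} {v : α → M} {xs : Fin n → M}

theorem holds_equal {t₁ t₂ : Language.ring.Term (α ⊕ Fin n)} :
    Holds M (.equal t₁ t₂) v xs ↔ termEval (Sum.elim v xs) t₁ = termEval (Sum.elim v xs) t₂ :=
  Iff.rfl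

theorem holds_imp {φ ψ : Language.ring.BoundedFormula α n} :
    Holds M (.imp φ ψ) v xs ↔ (Holds M φ v xs → Holds M ψ v xs) :=
  Iff.rfl

theorem holds_all {φ : Language.ring.BoundedFormula α (n + 1)} :
    Holds M (.all φ) v xs ↔ ∀ x, Holds M φ v (Fin.snoc xs x) :=
  Iff.rfl

end Clauses

variable {I : Type*} {U : Ultrafilter I} {M : Type*} [Field M]

theorem termEval_mk (w : I → α → M) (t : Language.ring.Term α) :
    termEval (fun s ↦ mk U fun i ↦ w i s) t = mk U fun i ↦ termEval (w i) t := by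
  have h := apply_termEval (mk U) (fun s i ↦ w i s) t
  refine h.symm.trans (congrArg _ (funext fun i ↦ ?_))
  exact apply_termEval (Pi.evalRingHom (fun _ ↦ M) i) _ t

theorem snoc_mk {n : ℕ} (xs : I → Fin n → M) (x : I → M) :
    (Fin.snoc (fun s ↦ mk U fun i ↦ xs i s) (mk U x) : Fin (n + 1) → Ultrapower U M) =
      fun s ↦ mk U fun i ↦ (Fin.snoc (xs i) (x i) : Fin (n + 1) → M) s := by
  funext s
  refine Fin.lastCases ?_ (fun s ↦ ?_) s <;> simp

/-- The theorem of Łoś on formulas in ultrapowers. -/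
theorem holds_mk_iff {n : ℕ} (φ : Language.ring.BoundedFormula α n) (v : I → α → M)
    (xs : I → Fin n → M) :
    Holds (Ultrapower U M) φ (fun s ↦ mk U fun i ↦ v i s) (fun s ↦ mk U fun i ↦ xs i s) ↔
      ∀ᶠ i in (U : Filter I), Holds M φ (v i) (xs i) := by
  induction φ with
  | falsum =>
    have h : ¬ ∀ᶠ _ in (U : Filter I), False := fun h ↦ h.exists.choose_spec
    exact ⟨False.elim, fun h' ↦ (h h').elim⟩
  | equal t₁ t₂ =>
    have hw : Sum.elim (fun s ↦ mk U fun i ↦ v i s) (fun s ↦ mk U fun i ↦ xs i s) =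
        fun s ↦ mk U fun i ↦ Sum.elim (v i) (xs i) s := by
      funext s
      rcases s with s | s <;> rfl
    rw [holds_equal, hw, termEval_mk, termEval_mk, mk_eq_mk]
    rfl
  | rel R _ => exact nomatch R
  | imp φ ψ h₁ h₂ =>
    rw [holds_imp, h₁, h₂, ← Ultrafilter.eventually_imp]
    rfl
  | all φ ih =>
    rw [holds_all]
    constructor
    · intro h
      by_contra hc
      rw [← Ultrafilter.eventually_not] at hc
      simp only [holds_all, not_forall] at hc
      obtain ⟨x, hx⟩ := hc.choice
      have hm := h (mk U x)
      rw [snoc_mk, ih] at hm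
      obtain ⟨i, h₁, h₂⟩ := (hx.and hm).exists
      exact h₁ h₂
    · intro h x
      obtain ⟨x, rfl⟩ := mk_surjective x
      rw [snoc_mk, ih]
      exact h.mono fun i hi ↦ holds_all.1 hi (x i)

theorem holds_diag_iff {n : ℕ} (φ : Language.ring.BoundedFormula α n) (v : α → M)
    (xs : Fin n → M) :
    Holds (Ultrapower U M) φ (diag U ∘ v) (diag U ∘ xs) ↔ Holds M φ v xs :=
  (holds_mk_iff φ (fun _ ↦ v) fun _ ↦ xs).trans Filter.eventually_const

end Formulas

section Transfer

theorem RACHom.comp {E A M : Type*} [Field E] [Field A] [Field M] {i : E →+* A} {j : A →+* M}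
    (hi : RACHom i) (hj : RACHom j) : RACHom (j.comp i) := by
  refine ((racHom_iff_comp j).1 hi).trans ?_ hj
  rintro _ ⟨x, rfl⟩
  exact ⟨i x, rfl⟩

theorem racHom_subtype_racl {M : Type*} [Field M] (k : Subfield M) :
    RACHom (racl k).subtype := by
  rw [RACHom, Subfield.fieldRange_subtype]
  exact relClosed_racl k ⊤

theorem exists_isCurve {E M : Type*} [Field E] [Field M] {i : E →+* M} (hi : RACHom i) {b : M}
    (hb : b ∉ i.fieldRange) :
    ∃ (A : Subfield M) (hbA : b ∈ A) (i' : E →+* A), A.subtype.comp i' = i ∧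
      IsCurve i' ⟨b, hbA⟩ ∧ RACHom A.subtype ∧ ∀ y, IsAlgebraic (adj i.fieldRange b) y → y ∈ A := by
  let A := racl (adj i.fieldRange b)
  have hbA : b ∈ A := le_racl _ (mem_adj _ _)
  have hA : i.fieldRange ≤ A := (le_adj _ _).trans (le_racl _)
  let i' : E →+* A := i.codRestrict A fun x ↦ hA ⟨x, rfl⟩
  have hi' : A.subtype.comp i' = i := rfl
  refine ⟨A, hbA, i', hi', (isCurve_iff_comp A.subtype).2 ?_, racHom_subtype_racl _,
    fun y ↦ mem_racl.2⟩
  rw [hi', Subfield.fieldRange_subtype]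
  exact ⟨hA, fun x _ hx ↦ hi x trivial hx, hbA, fun h ↦ hb (hi b trivial h), fun y ↦ mem_racl.1⟩

theorem Good.exists_extension {E M₁ M₂ : Type} [Field E] [Field M₁] [Field M₂] [CharZero M₁]
    (hM : Good M₁) {i₁ : E →+* M₁} (h₁ : RACHom i₁) {i₂ : E →+* M₂} (h₂ : RACHom i₂) {b : M₂}
    (hb : b ∉ i₂.fieldRange) :
    ∃ (A : Subfield M₂) (hbA : b ∈ A) (i : E →+* A) (I : Type) (V : Ultrafilter I)
      (e : A →+* Ultrapower V M₁), A.subtype.comp i = i₂ ∧ RACHom A.subtype ∧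
        e.comp i = (diag V).comp i₁ ∧ RACHom e ∧ (∀ x, e ⟨b, hbA⟩ ≠ diag V x) ∧
        ∀ y, IsAlgebraic (adj i₂.fieldRange b) y → y ∈ A := by
  obtain ⟨A, hbA, i, hi, hc, hA, halg⟩ := exists_isCurve h₂ hb
  obtain ⟨N, _, iA, iB, hcomm, hiA, hiB⟩ := exists_amalgam hc h₁
  obtain ⟨I, V, e, he, her⟩ := hM.exists_racHom hiB
  refine ⟨A, hbA, i, I, V, e.comp iA, hi, hA, ?_, hiA.comp her, fun x hx ↦ ?_, halg⟩
  · rw [RingHom.comp_assoc, hcomm, ← RingHom.comp_assoc, he]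
  · rw [← he] at hx
    have hx' : iA ⟨b, hbA⟩ = iB x := e.injective hx
    refine hiB.not_isAlgebraic ?_
    rw [hx']
    exact isAlgebraic_algebraMap (⟨iB x, x, rfl⟩ : iB.fieldRange)

theorem comp_snoc {A B : Type*} (f : A → B) {n : ℕ} (xs : Fin n → A) (x : A) :
    (Fin.snoc (f ∘ xs) (f x) : Fin (n + 1) → B) = f ∘ (Fin.snoc xs x : Fin (n + 1) → A) := by
  funext s
  refine Fin.lastCases ?_ (fun s ↦ ?_) s <;> simp

/-- Fields satisfying `Good` have the same theory over a common relatively algebraically closed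
subfield. -/
theorem Good.holds_iff {α : Type*} {n : ℕ} (φ : Language.ring.BoundedFormula α n)
    {E M₁ M₂ : Type} [Field E] [Field M₁] [Field M₂] [CharZero M₁] [CharZero M₂]
    (hM₁ : Good M₁) (hM₂ : Good M₂) {i₁ : E →+* M₁} (h₁ : RACHom i₁) {i₂ : E →+* M₂}
    (h₂ : RACHom i₂) (v : α → E) (xs : Fin n → E) :
    Holds M₁ φ (i₁ ∘ v) (i₁ ∘ xs) ↔ Holds M₂ φ (i₂ ∘ v) (i₂ ∘ xs) := by
  induction φ generalizing E M₁ M₂ with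
  | falsum => exact Iff.rfl
  | equal t₁ t₂ =>
    simp only [holds_equal, ← Sum.comp_elim, ← apply_termEval, i₁.injective.eq_iff,
      i₂.injective.eq_iff]
  | rel R _ => exact nomatch R
  | imp φ ψ hφ hψ => rw [holds_imp, holds_imp, hφ hM₁ hM₂ h₁ h₂, hψ hM₁ hM₂ h₁ h₂]
  | all φ ih =>
    have key {E M₁ M₂ : Type} [Field E] [Field M₁] [Field M₂] [CharZero M₁] [CharZero M₂]
        (hM₁ : Good M₁) (hM₂ : Good M₂) {i₁ : E →+* M₁} (h₁ : RACHom i₁) {i₂ : E →+* M₂}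
        (h₂ : RACHom i₂) (v : α → E) (xs : Fin _ → E)
        (h : Holds M₁ (.all φ) (i₁ ∘ v) (i₁ ∘ xs)) : Holds M₂ (.all φ) (i₂ ∘ v) (i₂ ∘ xs) := by
      rw [holds_all]
      intro b
      by_cases hb : b ∈ i₂.fieldRange
      · obtain ⟨c, rfl⟩ := hb
        rw [comp_snoc, ← ih hM₁ hM₂ h₁ h₂, ← comp_snoc]
        exact holds_all.1 h _
      · obtain ⟨A, hbA, i, I, V, e, hi, hA, he, her, -⟩ := hM₁.exists_extension h₁ h₂ hb
        have hall := (holds_diag_iff (U := V) _ _ _).2 h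
        have hv {β : Type _} (w : β → E) : diag V ∘ i₁ ∘ w = e ∘ i ∘ w :=
          funext fun s ↦ (RingHom.congr_fun he (w s)).symm
        have hxs : diag V ∘ i₁ ∘ xs = e ∘ i ∘ xs :=
          funext fun s ↦ (RingHom.congr_fun he (xs s)).symm
        have hb' := holds_all.1 hall (e ⟨b, hbA⟩)
        rw [hv, hxs, comp_snoc, ih (hM₁.ultrapower V) hM₂ her hA, ← comp_snoc] at hb'
        rw [← hi]
        exact hb'
    exact ⟨key hM₁ hM₂ h₁ h₂ v xs, key hM₂ hM₁ h₂ h₁ v xs⟩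

end Transfer

section Integers

/-- The exchange property of algebraic dependence. -/
theorem IsAlgebraic.exchange {k : Subfield Ω} {x y : Ω} (hy : ¬ IsAlgebraic k y)
    (h : IsAlgebraic (adj k x) y) : IsAlgebraic (adj k y) x := by
  by_cases hxy : x = y
  · rw [hxy]
    exact isAlgebraic_algebraMap (⟨y, mem_adj k y⟩ : adj k y)
  have key (u w : Ω) : Transcendental (Algebra.adjoin k (id '' {u})) (id w) ↔
      ¬ IsAlgebraic (adj k u) w := by
    rw [Set.image_id]
    exact not_congr isAlgebraic_adjoin_iff.symm
  have hone (u : Ω) : AlgebraicIndepOn k id {u} ↔ ¬ IsAlgebraic k u :=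
    algebraicIndependent_unique_type_iff
  by_contra hc
  have h₁ := (AlgebraicIndepOn.insert_iff (R := k) (x := (id : Ω → Ω)) (s := {y}) (i := x) hxy).2
    ⟨(hone y).2 hy, (key y x).2 hc⟩
  rw [Set.pair_comm, AlgebraicIndepOn.insert_iff (s := {x}) (i := y) (Ne.symm hxy), key] at h₁
  exact h₁.2 h

/-- An injective polynomial coding of pairs of integers, up to signs. -/
def code {R : Type*} [CommRing R] (x y : R) : R := (x ^ 2 + y ^ 2) ^ 2 + x ^ 2

theorem map_code {R S : Type*} [CommRing R] [CommRing S] (g : R →+* S) (x y : R) :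
    g (code x y) = code (g x) (g y) := by
  simp [code]

theorem code_inj {x y x' y' : ℤ} (h : code x y = code x' y') : x ^ 2 = x' ^ 2 := by
  have key {x y x' y' : ℤ} (h : code x y = code x' y') : x ^ 2 + y ^ 2 ≤ x' ^ 2 + y' ^ 2 := by
    by_contra! hlt
    simp only [code] at h
    nlinarith [sq_nonneg x, sq_nonneg y, sq_nonneg x', sq_nonneg y']
  have h' := le_antisymm (key h) (key h.symm)
  simp only [code, h'] at h
  linarith

theorem isAlgebraic_of_code_mem {k : Subfield Ω} {x y : Ω} (hx : x ∈ k) (h : code x y ∈ k) :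
    IsAlgebraic k y := by
  have hx' : IsAlgebraic k (x ^ 2) := isAlgebraic_algebraMap (⟨x, hx⟩ ^ 2 : k)
  have h₁ : IsAlgebraic k ((x ^ 2 + y ^ 2) ^ 2) := by
    have h₀ : (x ^ 2 + y ^ 2) ^ 2 = code x y - x ^ 2 := by simp [code]
    rw [h₀]
    exact (isAlgebraic_algebraMap (⟨code x y, h⟩ : k)).sub hx'
  refine IsAlgebraic.of_pow two_pos ?_
  have h₂ := (h₁.of_pow two_pos).sub hx'
  rwa [add_sub_cancel_left] at h₂

/-- Satisfaction of a formula in one variable with parameters. -/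
def Sat (M : Type*) [Field M] {α : Type*} (φ : Language.ring.BoundedFormula (α ⊕ Fin 1) 0)
    (c : α → M) (x : M) : Prop :=
  Holds M φ (Sum.elim c fun _ ↦ x) default

section Sat

variable {α : Type*} {φ : Language.ring.BoundedFormula (α ⊕ Fin 1) 0}

theorem sat_mk_iff {I : Type*} {U : Ultrafilter I} {M : Type*} [Field M] {c : α → M} {x : I → M} :
    Sat (Ultrapower U M) φ (diag U ∘ c) (mk U x) ↔ ∀ᶠ i in (U : Filter I), Sat M φ c (x i) := by
  rw [show (fun i ↦ Sat M φ c (x i)) = fun i ↦ Holds M φ (Sum.elim c fun _ ↦ x i) default from rfl,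
    ← holds_mk_iff, Sat]
  have hw : Sum.elim (diag U ∘ c) (fun _ : Fin 1 ↦ mk U x) =
      fun s ↦ mk U fun i ↦ Sum.elim c (fun _ ↦ x i) s := by
    funext s
    rcases s with s | s <;> rfl
  rw [hw, Subsingleton.elim default]

theorem sat_diag_iff {I : Type*} {U : Ultrafilter I} {M : Type*} [Field M] {c : α → M} {x : M} :
    Sat (Ultrapower U M) φ (diag U ∘ c) (diag U x) ↔ Sat M φ c x :=
  (sat_mk_iff (x := fun _ ↦ x)).trans Filter.eventually_const

/-- The polynomial `code` is injective, up to signs, on the solutions of a formula. -/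
def CodeInj (M : Type*) [Field M] (φ : Language.ring.BoundedFormula (α ⊕ Fin 1) 0)
    (c : α → M) : Prop :=
  ∀ x y x' y', Sat M φ c x → Sat M φ c y → Sat M φ c x' → Sat M φ c y' →
    code x y = code x' y' → x ^ 2 = x' ^ 2

theorem CodeInj.ultrapower {I : Type*} (U : Ultrafilter I) {M : Type*} [Field M] {c : α → M}
    (h : CodeInj M φ c) : CodeInj (Ultrapower U M) φ (diag U ∘ c) := by
  intro x y x' y' hx hy hx' hy' hc
  obtain ⟨x, rfl⟩ := mk_surjective x
  obtain ⟨y, rfl⟩ := mk_surjective y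
  obtain ⟨x', rfl⟩ := mk_surjective x'
  obtain ⟨y', rfl⟩ := mk_surjective y'
  rw [sat_mk_iff] at hx hy hx' hy'
  rw [← map_code, ← map_code, mk_eq_mk] at hc
  rw [← map_pow, ← map_pow, mk_eq_mk]
  filter_upwards [hx, hy, hx', hy', hc] with i hx hy hx' hy' hc
  refine h _ _ _ _ hx hy hx' hy' ?_
  have key (u v : I → M) : code u v i = code (u i) (v i) :=
    map_code (Pi.evalRingHom (fun _ ↦ M) i) u v
  rwa [key, key] at hc

theorem Good.sat_iff {E M₁ M₂ : Type} [Field E] [Field M₁] [Field M₂] [CharZero M₁] [CharZero M₂]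
    (hM₁ : Good M₁) (hM₂ : Good M₂) {i₁ : E →+* M₁} (h₁ : RACHom i₁) {i₂ : E →+* M₂}
    (h₂ : RACHom i₂) (c : α → E) (x : E) :
    Sat M₁ φ (i₁ ∘ c) (i₁ x) ↔ Sat M₂ φ (i₂ ∘ c) (i₂ x) := by
  have key {M : Type} (i : E → M) : Sum.elim (i ∘ c) (fun _ : Fin 1 ↦ i x) =
      i ∘ Sum.elim c fun _ ↦ x := by
    rw [Sum.comp_elim]
    rfl
  have h := hM₁.holds_iff φ hM₂ h₁ h₂ (Sum.elim c fun _ ↦ x) default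
  rw [← key, ← key] at h
  rw [Sat, Sat, Subsingleton.elim default (i₁ ∘ default), h,
    Subsingleton.elim default (i₂ ∘ default)]

end Sat

/-- In a field satisfying `Good`, the values of `code` at independent nonstandard solutions of a
formula do not determine the squares of the arguments. -/
theorem Good.not_codeInj {α : Type*} {φ : Language.ring.BoundedFormula (α ⊕ Fin 1) 0}
    {F M : Type} [Field F] [Field M] [CharZero M] (hM : Good M) {j : F →+* M} {c : α → F}
    {D : Subfield M} (hD : j.fieldRange ≤ D) {a b : M} (ha : a ∈ D)
    (haj : ¬ IsAlgebraic j.fieldRange a) (hb : ¬ IsAlgebraic D b) (hsa : Sat M φ (j ∘ c) a)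
    (hsb : Sat M φ (j ∘ c) b) : ¬ CodeInj M φ (j ∘ c) := by
  intro hinj
  have hn : ¬ IsAlgebraic D (code a b) := fun h ↦ hb <| by
    have hDn : ∀ y ∈ adj D (code a b), IsAlgebraic D y := fun y hy ↦
      mem_racl.1 (adj_le (le_racl D) (mem_racl.2 h) hy)
    exact isAlgebraic_trans (le_adj _ _) hDn
      (isAlgebraic_of_code_mem (le_adj _ _ ha) (mem_adj _ _))
  let E := racl (adj j.fieldRange (code a b))
  have hnE : code a b ∈ E := le_racl _ (mem_adj _ _)
  have hjE : j.fieldRange ≤ E := (le_adj _ _).trans (le_racl _)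
  let jE : F →+* E := j.codRestrict E fun x ↦ hjE ⟨x, rfl⟩
  have hE : RACHom E.subtype := racHom_subtype_racl _
  have haE : a ∉ E.subtype.fieldRange := by
    rw [Subfield.fieldRange_subtype]
    exact fun h ↦ hn (isAlgebraic_mono (adj_le hD ha) (IsAlgebraic.exchange haj (mem_racl.1 h)))
  obtain ⟨A, haA, i, I, V, e, hi, hA, he, her, hne, halg⟩ := hM.exists_extension hE hE haE
  have hbA : b ∈ A := by
    refine halg b (isAlgebraic_of_code_mem (mem_adj _ _) (le_adj _ _ ?_))
    rw [Subfield.fieldRange_subtype]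
    exact hnE
  have hcA : A.subtype ∘ i ∘ jE ∘ c = j ∘ c := funext fun s ↦ RingHom.congr_fun hi (jE (c s))
  have hce : e ∘ i ∘ jE ∘ c = diag V ∘ j ∘ c := funext fun s ↦ RingHom.congr_fun he (jE (c s))
  have hsat (x : A) (hx : Sat M φ (j ∘ c) x) : Sat (Ultrapower V M) φ (diag V ∘ j ∘ c) (e x) := by
    rw [← hce, ← hM.sat_iff (hM.ultrapower V) hA her, hcA]
    exact hx
  have hcode : code (e ⟨a, haA⟩) (e ⟨b, hbA⟩) = code (diag V a) (diag V b) := by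
    rw [← map_code, ← map_code]
    have hin : i ⟨code a b, hnE⟩ = code ⟨a, haA⟩ ⟨b, hbA⟩ := by
      refine A.subtype.injective ((RingHom.congr_fun hi _).trans ?_)
      rw [map_code]
      rfl
    rw [← hin]
    exact RingHom.congr_fun he _
  have hsq := hinj.ultrapower V _ _ _ _ (hsat ⟨a, haA⟩ hsa) (hsat ⟨b, hbA⟩ hsb)
    (sat_diag_iff.2 hsa) (sat_diag_iff.2 hsb) hcode
  rcases sq_eq_sq_iff_eq_or_eq_neg.1 hsq with h | h
  · exact hne a h
  · exact hne (-a) (by rw [h, map_neg])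

theorem Good.not_definable_int {α : Type*} {F : Type} [Field F] [CharZero F] (hF : Good F)
    (φ : Language.ring.BoundedFormula (α ⊕ Fin 1) 0) (c : α → F)
    (h : ∀ x, Sat F φ c x ↔ x ∈ Set.range (Int.cast : ℤ → F)) : False := by
  have hinj : CodeInj F φ c := by
    intro x y x' y' hx hy hx' hy' hc
    obtain ⟨x, rfl⟩ := (h _).1 hx
    obtain ⟨y, rfl⟩ := (h _).1 hy
    obtain ⟨x', rfl⟩ := (h _).1 hx'
    obtain ⟨y', rfl⟩ := (h _).1 hy'
    have hcast (u v : ℤ) : code (u : F) v = (code u v : ℤ) :=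
      (map_code (Int.castRingHom F) u v).symm
    rw [hcast, hcast, Int.cast_inj] at hc
    exact_mod_cast congrArg (Int.cast : ℤ → F) (code_inj hc)
  obtain ⟨U, hU⟩ := exists_ultrafilter_hilbertSet
  let M₀ := Ultrapower U F
  let M₁ := Ultrapower U M₀
  let a₀ : M₀ := mk U fun n : ℤ ↦ (n : F)
  have ha₀ : Sat M₀ φ (diag U ∘ c) a₀ :=
    sat_mk_iff.2 (Filter.Eventually.of_forall fun n ↦ (h _).2 ⟨n, rfl⟩)
  have h_sat (n : ℤ) : Sat M₀ φ (diag U ∘ c) (n : M₀) := by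
    rw [← map_intCast (diag U (M := F)) n]
    exact sat_diag_iff.2 ((h _).2 ⟨n, rfl⟩)
  let d : M₀ →+* M₁ := diag U
  let j : F →+* M₁ := d.comp (diag U)
  refine ((hF.ultrapower U).ultrapower U : Good M₁).not_codeInj (φ := φ) (j := j) (c := c)
    (D := d.fieldRange) (a := d a₀) (b := mk U fun n : ℤ ↦ (n : M₀)) ?_ ⟨a₀, rfl⟩ ?_
    (not_isAlgebraic_mk_intCast hU) (sat_diag_iff.2 ha₀)
    (sat_mk_iff.2 (Filter.Eventually.of_forall h_sat)) ((hinj.ultrapower U).ultrapower U)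
  · rintro _ ⟨x, rfl⟩
    exact ⟨diag U x, rfl⟩
  · rw [← RingHom.map_fieldRange, isAlgebraic_map_iff]
    exact not_isAlgebraic_mk_intCast hU

theorem Good.not_definableIn {F : Type} [Field F] [CharZero F] (hF : Good F) :
    ¬ DefinableIn F (intSet F) := by
  intro h
  let _ := FirstOrder.Ring.compatibleRingOfRing F
  obtain ⟨φ, hφ⟩ := Set.definable_iff_exists_formula_sum.1 (show Set.Definable _ _ _ from h)
  refine hF.not_definable_int φ Subtype.val fun x ↦ ?_
  exact (Set.ext_iff.1 hφ fun _ ↦ x).symm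

end Integers

end RelAlg

/-- The set of subfields `F` of `Q̄` in which `ℤ` is definable
(by a first-order formula in the language of rings with parameters from `F`)
is meager in the space `𝓔` of all subfields of `Q̄`. -/
theorem meager_int_definable :
    IsMeagre {F : Subfield Qbar | DefinableIn F (intSet F)} :=
  RelAlg.isMeagre_not_good.mono fun _ hF hgood ↦ RelAlg.Good.not_definableIn hgood hF
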